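/- The Heawood graph (the bipartite point–line incidence graph of the Fano plane PG(2,2); it is 3-regular on 14 vertices) has adjacency eigenvalues 3 and −3, each with multiplicity 1, and √2 and −√2, each with multiplicity 6. In particular its median eigenvalues are λ_7 = √2 and λ_8 = −√2, so its HL-index equals √2, and hence sup{R(G) : G a graph with maximum degree at most 3} = √2, with the supremum attained. -/

import Mathlib

open Polynomial in
/-- `μ` is the sequence of adjacency eigenvalues of `G`, listed with multiplicity
in decreasing order (so `μ ⟨i-1,_⟩` is the `i`-th largest eigenvalue `λ_i`). -/
def SimpleGraph.IsEigenvalueSeq {V : Type*} [Fintype V] [DecidableEq V]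
    (G : SimpleGraph V) (μ : Fin (Fintype.card V) → ℝ) : Prop :=
  Antitone μ ∧
    (letI : DecidableRel G.Adj := Classical.decRel _
     (SimpleGraph.adjMatrix ℝ G).charpoly) =
      ∏ i : Fin (Fintype.card V), (X - C (μ i))

/-- The Heawood graph: the bipartite point–line incidence graph of the Fano plane
`PG(2,2)`.  Points and lines are indexed by `ZMod 7`; the line `l` consists of the
points `{l, l+1, l+3}` (the set `{0,1,3}` is a perfect difference set mod 7). -/
def heawoodGraph : SimpleGraph (ZMod 7 ⊕ ZMod 7) :=
  SimpleGraph.fromRel (fun x y =>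
    match x, y with
    | Sum.inl p, Sum.inr l => p - l = 0 ∨ p - l = 1 ∨ p - l = 3
    | _, _ => False)

noncomputable instance : DecidableRel heawoodGraph.Adj := Classical.decRel _

section Spectral

open Polynomial Matrix

variable {V : Type*} [Fintype V] [DecidableEq V]

lemma hl_diag (A : Matrix V V ℝ) (hA : A.IsHermitian) :
    ∃ (P : Matrix V V ℝ) (d : V → ℝ), Pᵀ * P = 1 ∧ P * Pᵀ = 1 ∧
      A = P * Matrix.diagonal d * Pᵀ ∧ A.charpoly = ∏ i, (X - C (d i)) := by
  refine ⟨hA.eigenvectorUnitary, hA.eigenvalues, ?_, ?_, ?_, ?_⟩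
  · have := Unitary.coe_star_mul_self hA.eigenvectorUnitary
    rwa [Matrix.star_eq_conjTranspose, Matrix.conjTranspose_eq_transpose_of_trivial] at this
  · have := Unitary.coe_mul_star_self hA.eigenvectorUnitary
    rwa [Unitary.coe_star, Matrix.star_eq_conjTranspose, Matrix.conjTranspose_eq_transpose_of_trivial] at this
  · have := hA.spectral_theorem
    rw [Unitary.conjStarAlgAut_apply, Matrix.star_eq_conjTranspose,
      Matrix.conjTranspose_eq_transpose_of_trivial] at this
    exact this
  · exact hA.charpoly_eq

lemma hl_multiset {ι κ : Type*} [Fintype ι] [Fintype κ] (μ : ι → ℝ) (d : κ → ℝ)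
    (h : ∏ i, (X - C (μ i)) = ∏ i, (X - C (d i))) :
    (Finset.univ.val.map μ) = (Finset.univ.val.map d) := by
  have h1 := congrArg Polynomial.roots h
  rw [Polynomial.roots_prod _ _ (Finset.prod_ne_zero_iff.2 fun i _ => X_sub_C_ne_zero _),
    Polynomial.roots_prod _ _ (Finset.prod_ne_zero_iff.2 fun i _ => X_sub_C_ne_zero _)] at h1
  simpa [Multiset.bind_singleton] using h1

lemma hl_card {ι κ : Type*} [Fintype ι] [Fintype κ] (μ : ι → ℝ) (d : κ → ℝ)
    (h : ∏ i, (X - C (μ i)) = ∏ i, (X - C (d i))) (p : ℝ → Prop) [DecidablePred p] :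
    (Finset.univ.filter fun i => p (μ i)).card = (Finset.univ.filter fun i => p (d i)).card := by
  have h1 := congrArg (Multiset.countP p) (hl_multiset μ d h)
  rw [Multiset.countP_map, Multiset.countP_map] at h1
  exact h1

lemma hl_sum {ι κ : Type*} [Fintype ι] [Fintype κ] (μ : ι → ℝ) (d : κ → ℝ)
    (h : ∏ i, (X - C (μ i)) = ∏ i, (X - C (d i))) (f : ℝ → ℝ) :
    ∑ i, f (μ i) = ∑ i, f (d i) := by
  have h1 := congrArg (fun m => (Multiset.map f m).sum) (hl_multiset μ d h)
  simpa [Multiset.map_map] using h1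

/-- The counting form of the Courant-Fischer principle. -/
lemma hl_count (A : Matrix V V ℝ) (hA : A.IsHermitian) {ι : Type*} [Fintype ι] (μ : ι → ℝ)
    (hμ : A.charpoly = ∏ i, (X - C (μ i))) (ε s : ℝ)
    {U : Type*} [AddCommGroup U] [Module ℝ U] [FiniteDimensional ℝ U]
    (φ : U →ₗ[ℝ] (V → ℝ)) (hφ : Function.Injective φ)
    (hW : ∀ u, ε * (φ u ⬝ᵥ A *ᵥ φ u) ≤ s * (φ u ⬝ᵥ φ u)) :
    (Finset.univ.filter fun i => s < ε * μ i).card + Module.finrank ℝ U ≤ Fintype.card V := by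
  obtain ⟨P, d, h1, h2, h3, h4⟩ := hl_diag A hA
  rw [hl_card μ d (hμ.symm.trans h4) (fun t => s < ε * t)]
  let ψ : U →ₗ[ℝ] ({i // ¬ s < ε * d i} → ℝ) :=
    (LinearMap.funLeft ℝ ℝ Subtype.val).comp ((Matrix.mulVecLin Pᵀ).comp φ)
  have hψ : Function.Injective ψ := by
    rw [injective_iff_map_eq_zero]
    intro u hu
    have ha : ∀ i, ¬ s < ε * d i → (Pᵀ *ᵥ φ u) i = 0 := fun i hi => congrFun hu ⟨i, hi⟩
    set a := Pᵀ *ᵥ φ u with hadef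
    have hPa : φ u = P *ᵥ a := by rw [hadef, mulVec_mulVec, h2, one_mulVec]
    have e1 : φ u ⬝ᵥ φ u = ∑ i, a i * a i := by
      rw [hPa, dotProduct_mulVec, vecMul_mulVec, h1]
      simp [dotProduct]
    have e2 : φ u ⬝ᵥ A *ᵥ φ u = ∑ i, d i * (a i * a i) := by
      rw [h3, ← mulVec_mulVec, ← mulVec_mulVec, ← hadef, dotProduct_mulVec, ← mulVec_transpose,
        ← hadef]
      simp only [dotProduct, mulVec_diagonal]
      exact Finset.sum_congr rfl fun i _ => by ring
    have h5 := hW u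
    rw [e1, e2, Finset.mul_sum, Finset.mul_sum] at h5
    have h6 : ∑ i, (ε * d i - s) * (a i * a i) ≤ 0 := by
      have : ∑ i, (ε * d i - s) * (a i * a i) =
          ∑ i, ε * (d i * (a i * a i)) - ∑ i, s * (a i * a i) := by
        rw [← Finset.sum_sub_distrib]
        exact Finset.sum_congr rfl fun i _ => by ring
      linarith
    have h7 : ∀ i ∈ Finset.univ, 0 ≤ (ε * d i - s) * (a i * a i) := by
      intro i _
      by_cases hi : s < ε * d i
      · exact mul_nonneg (by linarith) (mul_self_nonneg _)
      · rw [ha i hi]; simp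
    have h8 := (Finset.sum_eq_zero_iff_of_nonneg h7).1 (le_antisymm h6 (Finset.sum_nonneg h7))
    have h9 : a = 0 := by
      funext i
      by_cases hi : s < ε * d i
      · have := h8 i (Finset.mem_univ _)
        rcases mul_eq_zero.1 this with h | h
        · linarith
        · simpa using h
      · exact ha i hi
    apply hφ
    rw [hPa, h9]; simp
  have h10 := LinearMap.finrank_le_finrank_of_injective hψ
  rw [Module.finrank_fintype_fun_eq_card, Fintype.card_subtype] at h10
  have h11 := Finset.card_filter_add_card_filter_not (s := (Finset.univ : Finset V)) (fun i => s < ε * d i)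
  rw [Finset.card_univ] at h11
  omega

/-- Existence of the sorted sequence of eigenvalues. -/
lemma hl_exists (A : Matrix V V ℝ) (hA : A.IsHermitian) :
    ∃ μ : Fin (Fintype.card V) → ℝ, Antitone μ ∧ A.charpoly = ∏ i, (X - C (μ i)) := by
  refine ⟨hA.eigenvalues₀, hA.eigenvalues₀_antitone, ?_⟩
  rw [hA.charpoly_eq]
  exact Equiv.prod_comp (Fintype.equivOfCardEq (Fintype.card_fin _)).symm
    (fun i => X - C (hA.eigenvalues₀ i))

lemma hl_pow_trace (A : Matrix V V ℝ) (hA : A.IsHermitian) {ι : Type*} [Fintype ι] (μ : ι → ℝ)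
    (hμ : A.charpoly = ∏ i, (X - C (μ i))) :
    ∑ i, μ i = A.trace ∧ ∑ i, μ i ^ 2 = (A * A).trace := by
  obtain ⟨P, d, h1, h2, h3, h4⟩ := hl_diag A hA
  have h := hμ.symm.trans h4
  rw [hl_sum μ d h (fun t => t ^ 2)]
  have h0 := hl_sum μ d h id
  simp only [id] at h0
  rw [h0]
  constructor
  · rw [h3, Matrix.trace_mul_comm, ← mul_assoc, h1]
    simp [Matrix.trace]
  · have : A * A = P * (diagonal d * diagonal d) * Pᵀ := by
      calc A * A = P * diagonal d * (Pᵀ * P) * diagonal d * Pᵀ := by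
            conv_lhs => rw [h3]
            simp only [mul_assoc]
        _ = _ := by rw [h1]; simp only [mul_assoc, mul_one]
    rw [this, Matrix.trace_mul_comm, ← mul_assoc, h1]
    simp [Matrix.trace, pow_two]

lemma hl_root (A : Matrix V V ℝ) {ι : Type*} [Fintype ι] (μ : ι → ℝ)
    (hμ : A.charpoly = ∏ i, (X - C (μ i))) (i : ι) :
    ∃ v : V → ℝ, v ≠ 0 ∧ A *ᵥ v = μ i • v := by
  have h : A.charpoly.IsRoot (μ i) := by
    rw [hμ, IsRoot, eval_prod]
    exact Finset.prod_eq_zero (Finset.mem_univ i) (by simp)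
  rw [IsRoot, Matrix.eval_charpoly] at h
  obtain ⟨v, hv, h'⟩ := Matrix.exists_mulVec_eq_zero_iff.2 h
  refine ⟨v, hv, ?_⟩
  rw [sub_mulVec, sub_eq_zero] at h'
  rw [← h']
  ext j; simp [Matrix.scalar_apply, mulVec_diagonal]

end Spectral

section Heawood

open Polynomial Matrix

/-- Boolean adjacency of the Heawood graph. -/
def hwAdj : ZMod 7 ⊕ ZMod 7 → ZMod 7 ⊕ ZMod 7 → Bool
  | Sum.inl p, Sum.inr l => decide (p - l = 0 ∨ p - l = 1 ∨ p - l = 3)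
  | Sum.inr l, Sum.inl p => decide (p - l = 0 ∨ p - l = 1 ∨ p - l = 3)
  | _, _ => false

lemma hw_adj (x y : ZMod 7 ⊕ ZMod 7) : heawoodGraph.Adj x y ↔ hwAdj x y = true := by
  rcases x with x | x <;> rcases y with y | y <;>
    simp [heawoodGraph, hwAdj, SimpleGraph.fromRel_adj]

/-- Natural number adjacency matrix of the Heawood graph. -/
def hwMat : Matrix (ZMod 7 ⊕ ZMod 7) (ZMod 7 ⊕ ZMod 7) ℕ := fun x y => if hwAdj x y then 1 else 0

/-- Square of the adjacency matrix of the Heawood graph. -/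
def hwSq : Matrix (ZMod 7 ⊕ ZMod 7) (ZMod 7 ⊕ ZMod 7) ℕ := fun x y =>
  if x = y then 3 else if x.isLeft = y.isLeft then 1 else 0

set_option maxRecDepth 100000 in
lemma hw_sq (x y : ZMod 7 ⊕ ZMod 7) : ∑ z, hwMat x z * hwMat z y = hwSq x y := by
  have : ∀ x y : ZMod 7 ⊕ ZMod 7, ∑ z, hwMat x z * hwMat z y = 1 * hwSq x y := by decide +kernel
  simpa using this x y

set_option maxRecDepth 100000 in
lemma hw_sq_sq (x y : ZMod 7 ⊕ ZMod 7) :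
    ∑ z, hwSq x z * hwSq z y + (if x = y then 18 else 0) = 11 * hwSq x y := by
  revert x y; decide +kernel

set_option maxRecDepth 100000 in
lemma hw_deg (x : ZMod 7 ⊕ ZMod 7) : (Finset.univ.filter fun y => hwAdj x y = true).card = 3 := by
  revert x; decide +kernel

lemma hw_regular : heawoodGraph.IsRegularOfDegree 3 := by
  intro v
  rw [← hw_deg v, ← SimpleGraph.card_neighborFinset_eq_degree]
  congr 1
  ext y
  simp [hw_adj]

lemma hw_adjMatrix [DecidableRel heawoodGraph.Adj] :
    heawoodGraph.adjMatrix ℝ = hwMat.map (Nat.cast : ℕ → ℝ) := by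
  ext x y
  simp only [SimpleGraph.adjMatrix_apply, hw_adj, hwMat, Matrix.map_apply]
  split_ifs <;> simp

lemma hw_mul : (hwMat.map (Nat.cast : ℕ → ℝ)) * (hwMat.map (Nat.cast : ℕ → ℝ)) =
    hwSq.map (Nat.cast : ℕ → ℝ) := by
  ext x y
  simp only [Matrix.mul_apply, Matrix.map_apply, ← hw_sq]
  push_cast; rfl

lemma hw_mul_mul : (hwSq.map (Nat.cast : ℕ → ℝ)) * (hwSq.map (Nat.cast : ℕ → ℝ)) +
    (18 : ℝ) • (1 : Matrix _ _ ℝ) = (11 : ℝ) • hwSq.map (Nat.cast : ℕ → ℝ) := by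
  ext x y
  have := congrArg (Nat.cast : ℕ → ℝ) (hw_sq_sq x y)
  push_cast at this
  simp only [Matrix.add_apply, Matrix.mul_apply, Matrix.map_apply, Matrix.smul_apply,
    Matrix.one_apply, smul_eq_mul]
  rw [← this]
  split_ifs <;> simp

lemma hl_initial {n : ℕ} (μ : Fin n → ℝ) (hμ : Antitone μ) (t : ℝ) (m : ℕ)
    (h : (Finset.univ.filter fun i => t ≤ μ i).card = m) (i : Fin n) :
    t ≤ μ i ↔ (i : ℕ) < m := by
  subst h
  constructor
  · intro hi
    have : Finset.Iic i ⊆ Finset.univ.filter fun i => t ≤ μ i := by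
      intro j hj
      simp only [Finset.mem_filter, Finset.mem_univ, true_and]
      exact hi.trans (hμ (Finset.mem_Iic.1 hj))
    have := Finset.card_le_card this
    rw [Fin.card_Iic] at this
    omega
  · intro hi
    by_contra hc
    have : (Finset.univ.filter fun i => t ≤ μ i) ⊆ Finset.Iio i := by
      intro j hj
      simp only [Finset.mem_filter, Finset.mem_univ, true_and] at hj
      rw [Finset.mem_Iio]
      by_contra hij
      exact hc (hj.trans (hμ (not_lt.1 hij)))
    have := Finset.card_le_card this
    rw [Fin.card_Iio] at this
    omega

lemma hl_values {n : ℕ} (hn : n = 14) (μ : Fin n → ℝ) (hμ : Antitone μ)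
    (h1 : ∑ i, μ i = 0) (h2 : ∑ i, μ i ^ 2 = 42)
    (h3 : ∀ i, (μ i ^ 2 - 9) * (μ i ^ 2 - 2) = 0) (i : Fin n) :
    ((i : ℕ) = 0 → μ i = 3) ∧
        (1 ≤ (i : ℕ) → (i : ℕ) ≤ 6 → μ i = Real.sqrt 2) ∧
        (7 ≤ (i : ℕ) → (i : ℕ) ≤ 12 → μ i = -Real.sqrt 2) ∧
        ((i : ℕ) = 13 → μ i = -3) := by
  have hs : Real.sqrt 2 * Real.sqrt 2 = 2 := Real.mul_self_sqrt (by norm_num)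
  have hs0 : 0 < Real.sqrt 2 := by positivity
  have hs3 : Real.sqrt 2 < 3 := by nlinarith
  set s := Real.sqrt 2 with hsdef
  have h4 : ∀ i, μ i = 3 ∨ μ i = -3 ∨ μ i = s ∨ μ i = -s := by
    intro i
    have h : (μ i - 3) * ((μ i + 3) * ((μ i - s) * (μ i + s))) = 0 := by
      rw [← h3 i]
      linear_combination (9 - μ i ^ 2) * hs
    rcases mul_eq_zero.1 h with h | h
    · left; linarith
    rcases mul_eq_zero.1 h with h | h
    · right; left; linarith
    rcases mul_eq_zero.1 h with h | h
    · right; right; left; linarith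
    · right; right; right; linarith
  obtain ⟨a, ha⟩ : ∃ a, a = (Finset.univ.filter fun i => μ i = 3).card := ⟨_, rfl⟩
  obtain ⟨b, hb⟩ : ∃ b, b = (Finset.univ.filter fun i => μ i = -3).card := ⟨_, rfl⟩
  obtain ⟨c, hc⟩ : ∃ c, c = (Finset.univ.filter fun i => μ i = s).card := ⟨_, rfl⟩
  obtain ⟨d, hd⟩ : ∃ d, d = (Finset.univ.filter fun i => μ i = -s).card := ⟨_, rfl⟩
  have key : ∀ f : ℝ → ℝ, ∑ i, f (μ i) = a * f 3 + b * f (-3) + c * f s + d * f (-s) := by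
    intro f
    have : ∀ i, f (μ i) = (if μ i = 3 then f 3 else 0) + (if μ i = -3 then f (-3) else 0)
        + (if μ i = s then f s else 0) + (if μ i = -s then f (-s) else 0) := by
      intro i
      rcases h4 i with h | h | h | h <;> rw [h]
      · rw [if_pos rfl, if_neg (by norm_num), if_neg (by linarith), if_neg (by linarith)]; ring
      · rw [if_neg (by norm_num), if_pos rfl, if_neg (by linarith), if_neg (by linarith)]; ring
      · rw [if_neg (by linarith), if_neg (by linarith), if_pos rfl, if_neg (by linarith)]; ring
      · rw [if_neg (by linarith), if_neg (by linarith), if_neg (by linarith), if_pos rfl]; ring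
    rw [Finset.sum_congr rfl fun i _ => this i]
    simp only [Finset.sum_add_distrib, ← Finset.sum_filter, Finset.sum_const, nsmul_eq_mul,
      ha, hb, hc, hd]
  have k0 := key (fun _ => 1)
  have k1 := key id
  have k2 := key (fun t => t ^ 2)
  simp only [Finset.sum_const, Finset.card_univ, Fintype.card_fin, nsmul_eq_mul, id, hn] at k0 k1 k2
  rw [h1] at k1
  rw [h2] at k2
  have e0 : (a : ℝ) + b + c + d = 14 := by push_cast at k0; linarith
  have e2 : 9 * ((a : ℝ) + b) + 2 * (c + d) = 42 := by
    linear_combination (-1) * k2 - (c + d) * hs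
  have e1 : 3 * ((a : ℝ) - b) = s * (d - c) := by linarith
  have e3 : 9 * ((a : ℝ) - b) ^ 2 = 2 * (d - c) ^ 2 := by
    linear_combination (3 * ((a : ℝ) - b) + s * (d - c)) * e1 + (d - c) ^ 2 * hs
  have f0 : (a : ℤ) + b + c + d = 14 := by exact_mod_cast e0
  have f2 : 9 * ((a : ℤ) + b) + 2 * (c + d) = 42 := by exact_mod_cast e2
  have f3 : 9 * ((a : ℤ) - b) ^ 2 = 2 * (d - c) ^ 2 := by exact_mod_cast e3
  have g : a = 1 ∧ b = 1 ∧ c = 6 ∧ d = 6 := by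
    have g1 : a + b = 2 := by omega
    have g2 : c + d = 12 := by omega
    have ha2 : a ≤ 2 := by omega
    have hc2 : c ≤ 12 := by omega
    obtain rfl : b = 2 - a := by omega
    obtain rfl : d = 12 - c := by omega
    clear ha hb hc hd key k0 k1 k2 e0 e1 e2 e3 f0 f2
    interval_cases a <;> interval_cases c <;> simp_all
  obtain ⟨rfl, rfl, rfl, rfl⟩ := g
  have cnt : ∀ t : ℝ, ((Finset.univ.filter fun i => t ≤ μ i).card : ℝ) =
      (if t ≤ 3 then 1 else 0) + (if t ≤ -3 then 1 else 0) + 6 * (if t ≤ s then 1 else 0) +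
        6 * (if t ≤ -s then 1 else 0) := by
    intro t
    have := key (fun x => if t ≤ x then 1 else 0)
    rw [Finset.sum_boole] at this
    rw [this]; push_cast; ring
  have c1 : (Finset.univ.filter fun i => (3:ℝ) ≤ μ i).card = 1 := by
    have := cnt 3
    rw [if_pos le_rfl, if_neg (by norm_num), if_neg (by linarith), if_neg (by linarith)] at this
    norm_num at this
    exact_mod_cast this
  have c2 : (Finset.univ.filter fun i => s ≤ μ i).card = 7 := by
    have := cnt s
    rw [if_pos (by linarith), if_neg (by linarith), if_pos le_rfl, if_neg (by linarith)] at this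
    norm_num at this
    exact_mod_cast this
  have c3 : (Finset.univ.filter fun i => -s ≤ μ i).card = 13 := by
    have := cnt (-s)
    rw [if_pos (by linarith), if_neg (by linarith), if_pos (by linarith), if_pos le_rfl] at this
    norm_num at this
    exact_mod_cast this
  have i1 := hl_initial μ hμ _ _ c1 i
  have i2 := hl_initial μ hμ _ _ c2 i
  have i3 := hl_initial μ hμ _ _ c3 i
  refine ⟨fun hi => ?_, fun hi hi' => ?_, fun hi hi' => ?_, fun hi => ?_⟩
  · have := i1.2 (by omega)
    rcases h4 i with h | h | h | h <;> linarith
  · have := i2.2 (by omega)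
    have := not_le.1 (mt i1.1 (by omega))
    rcases h4 i with h | h | h | h <;> linarith
  · have := i3.2 (by omega)
    have := not_le.1 (mt i2.1 (by omega))
    rcases h4 i with h | h | h | h <;> linarith
  · have := not_le.1 (mt i3.1 (by omega))
    rcases h4 i with h | h | h | h <;> linarith

lemma hw_card : Fintype.card (ZMod 7 ⊕ ZMod 7) = 14 := by
  simp [ZMod.card]

lemma hw_spec {n : ℕ} (hn : n = 14) (μ : Fin n → ℝ) (hμ : Antitone μ)
    (hc : (hwMat.map (Nat.cast : ℕ → ℝ)).charpoly = ∏ i, (X - C (μ i))) (i : Fin n) :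
    ((i : ℕ) = 0 → μ i = 3) ∧
        (1 ≤ (i : ℕ) → (i : ℕ) ≤ 6 → μ i = Real.sqrt 2) ∧
        (7 ≤ (i : ℕ) → (i : ℕ) ≤ 12 → μ i = -Real.sqrt 2) ∧
        ((i : ℕ) = 13 → μ i = -3) := by
  have hH : (hwMat.map (Nat.cast : ℕ → ℝ)).IsHermitian := by
    classical
    rw [← hw_adjMatrix, Matrix.IsHermitian, Matrix.conjTranspose_eq_transpose_of_trivial,
      SimpleGraph.transpose_adjMatrix]
  obtain ⟨t1, t2⟩ := hl_pow_trace _ hH μ hc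
  apply hl_values hn μ hμ
  · rw [t1]
    classical
    rw [← hw_adjMatrix, SimpleGraph.trace_adjMatrix]
  · rw [t2, hw_mul]
    simp only [Matrix.trace, Matrix.diag, Matrix.map_apply, hwSq, if_true]
    rw [Finset.sum_const, Finset.card_univ, hw_card]
    norm_num
  · intro i
    obtain ⟨v, hv, h⟩ := hl_root _ μ hc i
    have h2 : hwSq.map (Nat.cast : ℕ → ℝ) *ᵥ v = (μ i ^ 2) • v := by
      rw [← hw_mul, ← mulVec_mulVec, h, mulVec_smul, h, smul_smul, pow_two]
    have h4 := congrArg (fun M => M *ᵥ v) hw_mul_mul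
    simp only [add_mulVec, smul_mulVec, one_mulVec, ← mulVec_mulVec, h2, mulVec_smul] at h4
    obtain ⟨j, hj⟩ := Function.ne_iff.1 hv
    have h5 := congrFun h4 j
    simp only [Pi.add_apply, Pi.smul_apply, smul_eq_mul] at h5
    have : ((μ i ^ 2 - 9) * (μ i ^ 2 - 2)) * v j = 0 := by linear_combination h5
    exact (mul_eq_zero.1 this).resolve_right hj

end Heawood

section Cuts

set_option linter.unusedSectionVars false

variable {V : Type*} [Fintype V] [DecidableEq V] (G : SimpleGraph V) [DecidableRel G.Adj]

/-- The contribution of the pair `u`, `v` to the energy of a cut `c`. -/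
def hlPair (c : V → Bool) (u v : V) : ℤ :=
  if G.Adj u v then (if c v = c u then 1 else -1) else 0

/-- The energy of a cut. -/
def hlE (c : V → Bool) : ℤ := ∑ u, ∑ v, hlPair G c u v

/-- The local energy at a vertex. -/
def hlH (c : V → Bool) (v : V) : ℤ := ∑ w, hlPair G c v w

/-- Move the vertex `v` to the other side. -/
def hlFlip (c : V → Bool) (v : V) : V → Bool := fun u => if u = v then !c u else c u

/-- Maximum cuts. -/
def HlMin (c : V → Bool) : Prop := ∀ c', hlE G c ≤ hlE G c'

lemma hlPair_symm (c : V → Bool) (u v : V) : hlPair G c u v = hlPair G c v u := by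
  simp only [hlPair, G.adj_comm u v, eq_comm (a := c u)]

lemma hlE_flip (c : V → Bool) (v : V) : hlE G (hlFlip c v) = hlE G c - 4 * hlH G c v := by
  have key : ∀ u w, hlPair G (hlFlip c v) u w = hlPair G c u w
      - 2 * (if u = v then hlPair G c v w else 0) - 2 * (if w = v then hlPair G c v u else 0) := by
    intro u w
    by_cases hu : u = v <;> by_cases hw : w = v
    · subst hu; subst hw; simp [hlPair]
    · subst hu
      simp only [hlPair, hlFlip, hw, if_true, if_false]
      cases c w <;> cases c u <;> split_ifs <;> simp_all
    · subst hw
      rw [hlPair_symm G c w u]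
      simp only [hlPair, hlFlip, hu, if_true, if_false]
      cases c w <;> cases c u <;> split_ifs <;> simp_all
    · simp [hlPair, hlFlip, hu, hw]
  unfold hlE hlH
  simp only [key, Finset.sum_sub_distrib, ← Finset.mul_sum]
  have h1 : ∑ u, ∑ w, (if u = v then hlPair G c v w else 0) = ∑ w, hlPair G c v w := by
    rw [Finset.sum_eq_single v]
    · simp
    · intro b _ hb; simp [hb]
    · simp
  have h2 : ∑ u, ∑ w, (if w = v then hlPair G c v u else 0) = ∑ w, hlPair G c v w := by
    refine Finset.sum_congr rfl fun u _ => ?_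
    rw [Finset.sum_ite_eq' Finset.univ v]; simp
  rw [h1, h2]; ring

lemma hlH_flip (c : V → Bool) (v w : V) (hvw : G.Adj v w) (hc : c v ≠ c w) :
    hlH G (hlFlip c v) w = hlH G c w + 2 := by
  have key : ∀ u, hlPair G (hlFlip c v) w u = hlPair G c w u + (if u = v then 2 else 0) := by
    intro u
    have hne : w ≠ v := hvw.ne'
    by_cases hu : u = v
    · subst hu
      simp only [hlPair, hlFlip, hne, if_true, if_false, hvw.symm]
      revert hc
      cases c w <;> cases c u <;> simp
    · simp [hlPair, hlFlip, hu, hne]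
  unfold hlH
  simp only [key, Finset.sum_add_distrib]
  simp

/-- Neighbours on the same side. -/
def hlI (c : V → Bool) (v : V) : Finset V := Finset.univ.filter fun w => G.Adj v w ∧ c w = c v

/-- Neighbours on the other side. -/
def hlC (c : V → Bool) (v : V) : Finset V := Finset.univ.filter fun w => G.Adj v w ∧ c w ≠ c v

lemma hl_mem_I (c : V → Bool) (v w : V) : w ∈ hlI G c v ↔ G.Adj v w ∧ c w = c v := by
  simp [hlI]

lemma hl_mem_C (c : V → Bool) (v w : V) : w ∈ hlC G c v ↔ G.Adj v w ∧ c w ≠ c v := by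
  simp [hlC]

lemma hlH_eq (c : V → Bool) (v : V) : hlH G c v = (hlI G c v).card - (hlC G c v).card := by
  have : ∀ w, hlPair G c v w = (if G.Adj v w ∧ c w = c v then 1 else 0) -
      (if G.Adj v w ∧ c w ≠ c v then 1 else 0) := by
    intro w
    unfold hlPair
    by_cases h1 : G.Adj v w <;> by_cases h2 : c w = c v <;> simp [h1, h2]
  unfold hlH hlI hlC
  simp only [this, Finset.sum_sub_distrib, Finset.sum_boole]

lemma hl_card_add (c : V → Bool) (v : V) :
    (hlI G c v).card + (hlC G c v).card = G.degree v := by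
  rw [← SimpleGraph.card_neighborFinset_eq_degree, ← Finset.card_union_of_disjoint]
  · congr 1
    ext w
    simp only [Finset.mem_union, hl_mem_I, hl_mem_C, SimpleGraph.mem_neighborFinset]
    tauto
  · rw [Finset.disjoint_left]
    intro w h1 h2
    rw [hl_mem_I] at h1
    rw [hl_mem_C] at h2
    exact h2.2 h1.2

variable {G}

lemma hl_four (hd : ∀ v, G.degree v ≤ 3) {v a b x y : V} (ha : G.Adj v a) (hb : G.Adj v b)
    (hx : G.Adj v x) (hy : G.Adj v y) (h1 : a ≠ b) (h2 : a ≠ x) (h3 : a ≠ y) (h4 : b ≠ x)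
    (h5 : b ≠ y) (h6 : x ≠ y) : False := by
  have : ({a, b, x, y} : Finset V) ⊆ G.neighborFinset v := by
    intro t ht
    simp only [Finset.mem_insert, Finset.mem_singleton] at ht
    rw [SimpleGraph.mem_neighborFinset]
    rcases ht with rfl | rfl | rfl | rfl <;> assumption
  have := Finset.card_le_card this
  rw [SimpleGraph.card_neighborFinset_eq_degree] at this
  have h := hd v
  rw [Finset.card_eq_of_equiv_fin (n := 4)] at this
  · omega
  · exact Finset.equivFinOfCardEq (by
      rw [Finset.card_insert_of_notMem (by simp [h1, h2, h3]),
        Finset.card_insert_of_notMem (by simp [h4, h5]),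
        Finset.card_insert_of_notMem (by simp [h6]), Finset.card_singleton])

lemma HlMin.le {c : V → Bool} (hc : HlMin G c) (v : V) : (hlI G c v).card ≤ (hlC G c v).card := by
  have h1 := hc (hlFlip c v)
  rw [hlE_flip, hlH_eq] at h1
  omega

variable (G) in
/-- The vertex `v` has a neighbour on its own side. -/
def HlMt (c : V → Bool) (v : V) : Prop := ∃ u, G.Adj v u ∧ c u = c v

lemma HlMin.I_card (hd : ∀ v, G.degree v ≤ 3) {c : V → Bool} (hc : HlMin G c) (v : V) :
    (hlI G c v).card ≤ 1 := by
  have h1 := hc.le v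
  have h2 := hl_card_add G c v
  have h3 := hd v
  omega

lemma HlMin.uniq (hd : ∀ v, G.degree v ≤ 3) {c : V → Bool} (hc : HlMin G c) {v a b : V}
    (ha : G.Adj v a) (ha' : c a = c v) (hb : G.Adj v b) (hb' : c b = c v) : a = b :=
  Finset.card_le_one.1 (hc.I_card hd v) a ((hl_mem_I G c v a).2 ⟨ha, ha'⟩) b
    ((hl_mem_I G c v b).2 ⟨hb, hb'⟩)

lemma HlMt.card {c : V → Bool} {v : V} (h : HlMt G c v) : 1 ≤ (hlI G c v).card := by
  obtain ⟨u, h1, h2⟩ := h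
  exact Finset.card_pos.2 ⟨u, (hl_mem_I G c v u).2 ⟨h1, h2⟩⟩

lemma HlMt.C_card (hd : ∀ v, G.degree v ≤ 3) {c : V → Bool} {v : V} (h : HlMt G c v) :
    (hlC G c v).card ≤ 2 := by
  have h2 := hl_card_add G c v
  have h3 := hd v
  have := h.card
  omega

lemma hlC_card (hd : ∀ v, G.degree v ≤ 3) (c : V → Bool) (v : V) : (hlC G c v).card ≤ 3 := by
  have h2 := hl_card_add G c v
  have h3 := hd v
  omega

/-- Exchange two vertices. -/
def hlSwap (c : V → Bool) (v w : V) : V → Bool := hlFlip (hlFlip c v) w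

lemma HlMin.swap (hd : ∀ v, G.degree v ≤ 3) {c : V → Bool} (hc : HlMin G c) {v w : V}
    (hvw : G.Adj v w) (hne : c v ≠ c w) (hv : HlMt G c v) (hw : HlMt G c w) :
    HlMin G (hlSwap c v w) := by
  intro c'
  refine le_trans ?_ (hc c')
  unfold hlSwap
  rw [hlE_flip, hlH_flip G c v w hvw hne, hlE_flip, hlH_eq, hlH_eq]
  have := hv.card
  have := hw.card
  have := hv.C_card hd
  have := hw.C_card hd
  omega

lemma hlSwap_left (c : V → Bool) {v w : V} (h : v ≠ w) : hlSwap c v w v = !c v := by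
  simp [hlSwap, hlFlip, h]

lemma hlSwap_right (c : V → Bool) {v w : V} (h : v ≠ w) : hlSwap c v w w = !c w := by
  simp [hlSwap, hlFlip, h.symm]

lemma hlSwap_of_ne (c : V → Bool) {v w u : V} (h : u ≠ v) (h' : u ≠ w) :
    hlSwap c v w u = c u := by
  simp [hlSwap, hlFlip, h, h']

/-- Balanced cuts. -/
def HlBal (c : V → Bool) : Prop :=
  (Finset.univ.filter fun v => c v = true).card = (Finset.univ.filter fun v => c v = false).card

lemma HlBal.swap {c : V → Bool} (hc : HlBal c) {v w : V} (hne : c v ≠ c w) :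
    HlBal (hlSwap c v w) := by
  have hvw : v ≠ w := fun h => hne (by rw [h])
  have key : ∀ b : Bool, (Finset.univ.filter fun u => hlSwap c v w u = b).card =
      (Finset.univ.filter fun u => c u = b).card := by
    intro b
    apply Finset.card_bij (fun u _ => Equiv.swap v w u)
    · intro u hu
      simp only [Finset.mem_filter, Finset.mem_univ, true_and] at hu ⊢
      rw [← hu]
      by_cases h1 : u = v
      · subst h1
        rw [Equiv.swap_apply_left, hlSwap_left c hvw]
        revert hne; cases c u <;> cases c w <;> simp
      by_cases h2 : u = w
      · subst h2
        rw [Equiv.swap_apply_right, hlSwap_right c hvw]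
        revert hne; cases c u <;> cases c v <;> simp
      rw [Equiv.swap_apply_of_ne_of_ne h1 h2, hlSwap_of_ne c h1 h2]
    · intro a _ b _ h
      exact (Equiv.swap v w).injective h
    · intro u hu
      refine ⟨Equiv.swap v w u, ?_, by simp⟩
      simp only [Finset.mem_filter, Finset.mem_univ, true_and] at hu ⊢
      rw [← hu]
      by_cases h1 : u = v
      · subst h1
        rw [Equiv.swap_apply_left, hlSwap_right c hvw]
        revert hne; cases c u <;> cases c w <;> simp
      by_cases h2 : u = w
      · subst h2
        rw [Equiv.swap_apply_right, hlSwap_left c hvw]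
        revert hne; cases c u <;> cases c v <;> simp
      rw [Equiv.swap_apply_of_ne_of_ne h1 h2, hlSwap_of_ne c h1 h2]
  unfold HlBal
  rw [key, key]
  exact hc

/-- The structure lemma. -/
lemma HlMin.struct (hd : ∀ v, G.degree v ≤ 3) {c : V → Bool} (hc : HlMin G c) {v w1 w2 : V}
    (hv : HlMt G c v) (h1 : w1 ∈ hlC G c v) (h2 : w2 ∈ hlC G c v) (hne : w1 ≠ w2)
    (hm1 : HlMt G c w1) (hm2 : HlMt G c w2) : G.Adj w1 w2 := by
  rw [hl_mem_C] at h1 h2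
  obtain ⟨y, hy, hyc⟩ := id hm2
  by_cases hyw : y = w1
  · rw [← hyw]; exact hy.symm
  exfalso
  have hmin := hc.swap hd h1.1 (Ne.symm h1.2) hv hm1
  have hw2v : w2 ≠ v := h2.1.ne'
  have hyv : y ≠ v := by rintro rfl; exact h2.2 hyc.symm
  refine hyv (hmin.uniq hd (v := w2) hy ?_ h2.1.symm ?_)
  · rw [hlSwap_of_ne c hyv hyw, hlSwap_of_ne c hw2v hne.symm, hyc]
  · rw [hlSwap_left c h1.1.ne, hlSwap_of_ne c hw2v hne.symm]
    have := h2.2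
    revert this; cases c v <;> cases c w2 <;> simp

lemma hl_exists_min : ∃ c : V → Bool, HlMin G c := by
  obtain ⟨c, hc⟩ := Finite.exists_min (hlE G)
  exact ⟨c, hc⟩

end Cuts

section Test

set_option linter.unusedSectionVars false

open Matrix Polynomial

variable {V : Type*} [Fintype V] [DecidableEq V] (G : SimpleGraph V) [DecidableRel G.Adj]

/-- Adjacency inside the two sides. -/
noncomputable def hlM (c : V → Bool) : Matrix V V ℝ :=
  Matrix.of fun u v => if G.Adj u v ∧ c v = c u then 1 else 0

/-- Adjacency across the cut. -/
noncomputable def hlN (c : V → Bool) : Matrix V V ℝ :=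
  Matrix.of fun u v => if G.Adj u v ∧ c v ≠ c u then 1 else 0

open Classical in
/-- The entries of the inverse of `√2 - ε M`. -/
noncomputable def hlDe (ε : ℝ) (c : V → Bool) (u v : V) : ℝ :=
  if u = v then (if HlMt G c u then √2 else √2 / 2)
    else if G.Adj u v ∧ c v = c u then ε else 0

/-- The inverse of `√2 - ε M`. -/
noncomputable def hlD (ε : ℝ) (c : V → Bool) : Matrix V V ℝ :=
  Matrix.of fun u v => hlDe G ε c u v

lemma hl_adj_eq (c : V → Bool) : G.adjMatrix ℝ = hlM G c + hlN G c := by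
  ext u v
  simp only [SimpleGraph.adjMatrix_apply, hlM, hlN, Matrix.add_apply, Matrix.of_apply]
  by_cases h1 : G.Adj u v <;> by_cases h2 : c v = c u <;> simp [h1, h2]

lemma hlM_symm (c : V → Bool) : (hlM G c)ᵀ = hlM G c := by
  ext u v
  simp only [hlM, Matrix.transpose_apply, Matrix.of_apply, G.adj_comm u v, eq_comm (a := c u)]

lemma hlN_symm (c : V → Bool) : (hlN G c)ᵀ = hlN G c := by
  ext u v
  simp only [hlN, Matrix.transpose_apply, Matrix.of_apply, G.adj_comm u v, ne_comm (a := c u)]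

lemma hlD_symm (ε : ℝ) (c : V → Bool) (u v : V) : hlDe G ε c u v = hlDe G ε c v u := by
  simp only [hlDe, G.adj_comm u v, eq_comm (a := c u), eq_comm (a := u)]
  by_cases h : v = u
  · subst h; rfl
  · simp [h]

lemma hlD_diag {ε : ℝ} {c : V → Bool} {w : V} (h : HlMt G c w) : hlDe G ε c w w = √2 := by
  simp [hlDe, h]

lemma hlD_diag' {ε : ℝ} {c : V → Bool} {w : V} (h : ¬ HlMt G c w) : hlDe G ε c w w = √2 / 2 := by
  simp [hlDe, h]

lemma hlD_adj {ε : ℝ} {c : V → Bool} {u w : V} (h : G.Adj u w) (h' : c w = c u) :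
    hlDe G ε c u w = ε := by
  simp [hlDe, h, h', h.ne]

lemma hlD_zero {ε : ℝ} {c : V → Bool} {u w : V} (hne : u ≠ w) (h : ¬ (G.Adj u w ∧ c w = c u)) :
    hlDe G ε c u w = 0 := by
  simp only [hlDe, if_neg hne, if_neg h]

variable {G}

open Classical in
lemma hlM_sq (hd : ∀ v, G.degree v ≤ 3) {c : V → Bool} (hc : HlMin G c) :
    hlM G c * hlM G c = Matrix.diagonal fun u => if HlMt G c u then 1 else 0 := by
  ext u v
  rw [Matrix.mul_apply, Matrix.diagonal_apply]
  simp only [hlM, Matrix.of_apply]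
  by_cases hu : HlMt G c u
  · obtain ⟨p, hp, hpc⟩ := id hu
    rw [Finset.sum_eq_single p]
    · rw [if_pos ⟨hp, hpc⟩, one_mul, if_pos hu]
      by_cases huv : u = v
      · subst huv
        rw [if_pos ⟨hp.symm, hpc.symm⟩, if_pos rfl]
      · rw [if_neg huv, if_neg]
        rintro ⟨h1, h2⟩
        exact huv (hc.uniq hd hp.symm hpc.symm h1 h2)
    · intro b _ hb
      rw [if_neg, zero_mul]
      rintro ⟨h1, h2⟩
      exact hb (hc.uniq hd h1 h2 hp hpc)
    · simp
  · rw [if_neg hu, ite_self]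
    apply Finset.sum_eq_zero
    intro b _
    rw [if_neg, zero_mul]
    exact fun h => hu ⟨b, h⟩

open Classical in
lemma hlM_diag (c : V → Bool) :
    hlM G c * (Matrix.diagonal fun u => if HlMt G c u then (1 : ℝ) else 0) = hlM G c := by
  ext u v
  rw [Matrix.mul_diagonal]
  simp only [hlM, Matrix.of_apply]
  by_cases h : G.Adj u v ∧ c v = c u
  · rw [if_pos h, if_pos ⟨u, h.1.symm, h.2.symm⟩, mul_one]
  · rw [if_neg h, zero_mul]

lemma hlD_mul (hd : ∀ v, G.degree v ≤ 3) {c : V → Bool} (hc : HlMin G c) {ε : ℝ}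
    (hε : ε * ε = 1) : (√2 • (1 : Matrix V V ℝ) - ε • hlM G c) * hlD G ε c = 1 := by
  classical
  have hs : √2 * √2 = 2 := Real.mul_self_sqrt (by norm_num)
  have hD : hlD G ε c = (√2 / 2) • (1 : Matrix V V ℝ) + ε • hlM G c +
      (√2 / 2) • (Matrix.diagonal fun u => if HlMt G c u then (1 : ℝ) else 0) := by
    ext u v
    simp only [hlD, hlDe, hlM, Matrix.of_apply, Matrix.add_apply, Matrix.smul_apply, Matrix.one_apply,
      Matrix.diagonal_apply, smul_eq_mul]
    by_cases h : u = v
    · subst h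
      by_cases h2 : HlMt G c u <;> simp [h2]
    · by_cases h2 : G.Adj u v ∧ c v = c u
      · simp [h, h2]
      · simp [h, h2]
  rw [hD]
  simp only [sub_mul, mul_add, smul_mul_smul_comm, one_mul, mul_one, hlM_sq hd hc, hlM_diag, hε]
  have e1 : √2 * (√2 / 2) = 1 := by linarith
  rw [e1, mul_comm √2 ε]
  have e2 : (ε * √2) = ε * (√2 / 2) + ε * (√2 / 2) := by ring
  rw [e2, add_smul]
  module

lemma hl_M_le (hd : ∀ v, G.degree v ≤ 3) {c : V → Bool} (hc : HlMin G c) {ε : ℝ}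
    (hε : ε = 1 ∨ ε = -1) (u : V → ℝ) : ε * (u ⬝ᵥ hlM G c *ᵥ u) ≤ u ⬝ᵥ u := by
  have hrow : ∀ a, ∑ b, hlM G c a b ≤ 1 := by
    intro a
    simp only [hlM, Matrix.of_apply, Finset.sum_boole]
    exact_mod_cast hc.I_card hd a
  have h0 : ∀ a b, 0 ≤ hlM G c a b := by
    intro a b
    simp only [hlM, Matrix.of_apply]
    split_ifs <;> norm_num
  have hsy : ∀ a b, hlM G c a b = hlM G c b a := fun a b => by
    conv_lhs => rw [← hlM_symm]
    rfl
  have e : ε * (u ⬝ᵥ hlM G c *ᵥ u) = ∑ a, ∑ b, ε * (hlM G c a b * (u a * u b)) := by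
    simp only [dotProduct, mulVec, Finset.mul_sum]
    refine Finset.sum_congr rfl fun a _ => Finset.sum_congr rfl fun b _ => by ring
  rw [e]
  have h1 : ∀ a b, ε * (hlM G c a b * (u a * u b)) ≤
      hlM G c a b * (u a * u a) / 2 + hlM G c b a * (u b * u b) / 2 := by
    intro a b
    rw [← hsy a b]
    have := h0 a b
    rcases hε with rfl | rfl
    · nlinarith [mul_nonneg this (mul_self_nonneg (u a - u b))]
    · nlinarith [mul_nonneg this (mul_self_nonneg (u a + u b))]
  have h2 : ∑ a, ∑ b, hlM G c a b * (u a * u a) / 2 ≤ (u ⬝ᵥ u) / 2 := by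
    simp only [dotProduct, ← Finset.sum_div, ← Finset.sum_mul]
    have : ∑ a, (∑ b, hlM G c a b) * (u a * u a) ≤ ∑ a, u a * u a :=
      Finset.sum_le_sum fun a _ => by nlinarith [hrow a, mul_self_nonneg (u a)]
    linarith
  have h3 : ∑ a, ∑ b, hlM G c b a * (u b * u b) / 2 ≤ (u ⬝ᵥ u) / 2 := by
    rw [Finset.sum_comm]; exact h2
  calc _ ≤ ∑ a, ∑ b, (hlM G c a b * (u a * u a) / 2 + hlM G c b a * (u b * u b) / 2) :=
        Finset.sum_le_sum fun a _ => Finset.sum_le_sum fun b _ => h1 a b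
    _ ≤ _ := by simp only [Finset.sum_add_distrib]; linarith

lemma hl_form (hd : ∀ v, G.degree v ≤ 3) {c : V → Bool} (hc : HlMin G c) {ε : ℝ}
    (hε : ε = 1 ∨ ε = -1) (b : Bool) (x y : V → ℝ) (hx : ∀ v, c v ≠ b → x v = 0)
    (hy : ∀ v, c v = b → y v = 0)
    (hq : (hlN G c *ᵥ x) ⬝ᵥ hlD G ε c *ᵥ (hlN G c *ᵥ x) ≤
      √2 * (x ⬝ᵥ x) - ε * (x ⬝ᵥ hlM G c *ᵥ x)) (t : ℝ) :
    ε * ((t • x + y) ⬝ᵥ G.adjMatrix ℝ *ᵥ (t • x + y)) ≤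
      √2 * ((t • x + y) ⬝ᵥ (t • x + y)) := by
  have hεε : ε * ε = 1 := by rcases hε with rfl | rfl <;> norm_num
  have hs1 : 1 ≤ √2 := by
    have : √2 * √2 = 2 := Real.mul_self_sqrt (by norm_num)
    nlinarith [Real.sqrt_nonneg 2]
  have hxy : x ⬝ᵥ y = 0 := by
    apply Finset.sum_eq_zero
    intro v _
    by_cases h : c v = b
    · rw [hy v h, mul_zero]
    · rw [hx v h, zero_mul]
  have hM : ∀ p q : V → ℝ, (∀ u v, c v = c u → p u * q v = 0) → p ⬝ᵥ hlM G c *ᵥ q = 0 := by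
    intro p q h
    simp only [dotProduct, mulVec, Finset.mul_sum]
    refine Finset.sum_eq_zero fun u _ => Finset.sum_eq_zero fun v _ => ?_
    simp only [hlM, Matrix.of_apply]
    split_ifs with h1
    · rw [one_mul]; exact h u v h1.2
    · simp
  have hN : ∀ p q : V → ℝ, (∀ u v, c v ≠ c u → p u * q v = 0) → p ⬝ᵥ hlN G c *ᵥ q = 0 := by
    intro p q h
    simp only [dotProduct, mulVec, Finset.mul_sum]
    refine Finset.sum_eq_zero fun u _ => Finset.sum_eq_zero fun v _ => ?_
    simp only [hlN, Matrix.of_apply]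
    split_ifs with h1
    · rw [one_mul]; exact h u v h1.2
    · simp
  have m1 : x ⬝ᵥ hlM G c *ᵥ y = 0 := hM _ _ fun u v h => by
    by_cases h2 : c v = b
    · rw [hy v h2, mul_zero]
    · rw [hx u (by rwa [← h]), zero_mul]
  have m2 : y ⬝ᵥ hlM G c *ᵥ x = 0 := hM _ _ fun u v h => by
    by_cases h2 : c v = b
    · rw [hy u (by rwa [← h]), zero_mul]
    · rw [hx v h2, mul_zero]
  have n1 : x ⬝ᵥ hlN G c *ᵥ x = 0 := hN _ _ fun u v h => by
    by_cases h2 : c v = b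
    · rw [hx u (fun h3 => h (h2.trans h3.symm)), zero_mul]
    · rw [hx v h2, mul_zero]
  have n2 : y ⬝ᵥ hlN G c *ᵥ y = 0 := hN _ _ fun u v h => by
    by_cases h2 : c v = b
    · rw [hy v h2, mul_zero]
    · rw [hy u (by revert h h2; cases c u <;> cases c v <;> cases b <;> simp), zero_mul]
  have n3 : x ⬝ᵥ hlN G c *ᵥ y = y ⬝ᵥ hlN G c *ᵥ x := by
    rw [dotProduct_mulVec, ← mulVec_transpose, hlN_symm, dotProduct_comm]
  set g := hlN G c *ᵥ x with hg
  set z := y - (t * ε) • (hlD G ε c *ᵥ g) with hz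
  have hSD : √2 • (hlD G ε c *ᵥ g) - ε • (hlM G c *ᵥ (hlD G ε c *ᵥ g)) = g := by
    have := congrArg (fun A => A *ᵥ g) (hlD_mul hd hc hεε)
    simpa only [← mulVec_mulVec, sub_mulVec, smul_mulVec, one_mulVec] using this
  set r := hlD G ε c *ᵥ g with hr
  have hz0 := hl_M_le hd hc hε z
  have hzz : 0 ≤ z ⬝ᵥ z := Finset.sum_nonneg fun i _ => mul_self_nonneg _
  have hz1 : ε * (z ⬝ᵥ hlM G c *ᵥ z) ≤ √2 * (z ⬝ᵥ z) := by nlinarith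
  have hrM : r ⬝ᵥ hlM G c *ᵥ y = y ⬝ᵥ hlM G c *ᵥ r := by
    rw [dotProduct_mulVec, ← mulVec_transpose, hlM_symm, dotProduct_comm]
  have k1 : √2 * (y ⬝ᵥ r) - ε * (y ⬝ᵥ hlM G c *ᵥ r) = y ⬝ᵥ g := by
    conv_rhs => rw [← hSD]
    simp only [dotProduct_sub, dotProduct_smul, smul_eq_mul]
  have k2 : √2 * (r ⬝ᵥ r) - ε * (r ⬝ᵥ hlM G c *ᵥ r) = g ⬝ᵥ r := by
    rw [dotProduct_comm g r]
    conv_rhs => rw [← hSD]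
    simp only [dotProduct_sub, dotProduct_smul, smul_eq_mul]
  rw [hz] at hz1
  simp only [mulVec_sub, mulVec_smul, dotProduct_sub, sub_dotProduct, dotProduct_smul,
    smul_dotProduct, smul_eq_mul, hrM, dotProduct_comm r y] at hz1
  rw [hl_adj_eq G c]
  simp only [add_mulVec, mulVec_add, mulVec_smul, dotProduct_add, add_dotProduct, dotProduct_smul,
    smul_dotProduct, smul_eq_mul, m1, m2, n1, n2, n3, dotProduct_comm y x, hxy, ← hg]
  have ht : 0 ≤ t ^ 2 := sq_nonneg t
  have hq2 := mul_le_mul_of_nonneg_left hq ht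
  have e1 : √2 * (y ⬝ᵥ y) - ε * (y ⬝ᵥ hlM G c *ᵥ y) - 2 * (t * ε) * (y ⬝ᵥ g)
      + t ^ 2 * (g ⬝ᵥ r) ≥ 0 := by
    rw [← k1, ← k2]
    have hc2 : (t * ε) * (t * ε) = t ^ 2 := by linear_combination t ^ 2 * hεε
    rw [← hc2]
    linarith
  nlinarith

lemma hl_test (hd : ∀ v, G.degree v ≤ 3) {c : V → Bool} (hc : HlMin G c) {ε : ℝ}
    (hε : ε = 1 ∨ ε = -1) (b : Bool) (x : V → ℝ) (hx : ∀ v, c v ≠ b → x v = 0) (hx0 : x ≠ 0)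
    (hq : (hlN G c *ᵥ x) ⬝ᵥ hlD G ε c *ᵥ (hlN G c *ᵥ x) ≤
      √2 * (x ⬝ᵥ x) - ε * (x ⬝ᵥ hlM G c *ᵥ x))
    {ι : Type*} [Fintype ι] (μ : ι → ℝ)
    (hμ : (G.adjMatrix ℝ).charpoly = ∏ i, (X - C (μ i))) :
    (Finset.univ.filter fun i => √2 < ε * μ i).card +
      ((Finset.univ.filter fun v => c v ≠ b).card + 1) ≤ Fintype.card V := by
  have hA : (G.adjMatrix ℝ).IsHermitian := by
    rw [Matrix.IsHermitian, Matrix.conjTranspose_eq_transpose_of_trivial,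
      SimpleGraph.transpose_adjMatrix]
  let e : ({v // c v ≠ b} → ℝ) →ₗ[ℝ] (V → ℝ) :=
    { toFun := fun f v => if h : c v ≠ b then f ⟨v, h⟩ else 0
      map_add' := by
        intro f g; funext v
        by_cases h : c v = b <;> simp [h]
      map_smul' := by
        intro r f; funext v
        by_cases h : c v = b <;> simp [h] }
  let φ : (({v // c v ≠ b} → ℝ) × ℝ) →ₗ[ℝ] (V → ℝ) :=
    (LinearMap.toSpanSingleton ℝ (V → ℝ) x).comp (LinearMap.snd ℝ _ _) +
      e.comp (LinearMap.fst ℝ _ _)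
  have hφ : ∀ p, φ p = p.2 • x + e p.1 := fun p => rfl
  have he : ∀ f v, c v = b → e f v = 0 := by
    intro f v h
    simp [e, h]
  have he' : ∀ f v (h : c v ≠ b), e f v = f ⟨v, h⟩ := by
    intro f v h
    simp [e, h]
  have hinj : Function.Injective φ := by
    rw [injective_iff_map_eq_zero]
    rintro ⟨f, t⟩ h
    rw [hφ] at h
    obtain ⟨v, hv⟩ := Function.ne_iff.1 hx0
    have hvb : c v = b := by by_contra hn; exact hv (hx v hn)
    have ht : t = 0 := by
      have := congrFun h v
      simp only [Pi.add_apply, he f v hvb, Pi.smul_apply, smul_eq_mul, add_zero, Pi.zero_apply] at this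
      exact (mul_eq_zero.1 this).resolve_right hv
    subst ht
    refine Prod.ext ?_ rfl
    funext w
    have := congrFun h w.1
    simp only [Pi.add_apply, he' f w.1 w.2, zero_smul, zero_add, Pi.zero_apply] at this
    exact this
  have := hl_count (G.adjMatrix ℝ) hA μ hμ ε √2 φ hinj (fun p => by
    rw [hφ]
    exact hl_form hd hc hε b x (e p.1) hx (fun v h => he _ v h) hq p.2)
  rwa [Module.finrank_prod, Module.finrank_self, Module.finrank_fintype_fun_eq_card,
    Fintype.card_subtype] at this

lemma hl_test_unbal (hd : ∀ v, G.degree v ≤ 3) {c : V → Bool} (hc : HlMin G c) {ε : ℝ}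
    (hε : ε = 1 ∨ ε = -1) (b : Bool) {ι : Type*} [Fintype ι] (μ : ι → ℝ)
    (hμ : (G.adjMatrix ℝ).charpoly = ∏ i, (X - C (μ i))) :
    (Finset.univ.filter fun i => √2 < ε * μ i).card +
      (Finset.univ.filter fun v => c v ≠ b).card ≤ Fintype.card V := by
  have hA : (G.adjMatrix ℝ).IsHermitian := by
    rw [Matrix.IsHermitian, Matrix.conjTranspose_eq_transpose_of_trivial,
      SimpleGraph.transpose_adjMatrix]
  let e : ({v // c v ≠ b} → ℝ) →ₗ[ℝ] (V → ℝ) :=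
    { toFun := fun f v => if h : c v ≠ b then f ⟨v, h⟩ else 0
      map_add' := by
        intro f g; funext v
        by_cases h : c v = b <;> simp [h]
      map_smul' := by
        intro r f; funext v
        by_cases h : c v = b <;> simp [h] }
  have he : ∀ f v, c v = b → e f v = 0 := by
    intro f v h
    simp [e, h]
  have he' : ∀ f v (h : c v ≠ b), e f v = f ⟨v, h⟩ := by
    intro f v h
    simp [e, h]
  have hinj : Function.Injective e := by
    rw [injective_iff_map_eq_zero]
    intro f h
    funext w
    have := congrFun h w.1
    rwa [he' f w.1 w.2] at this
  have := hl_count (G.adjMatrix ℝ) hA μ hμ ε √2 e hinj (fun p => by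
    have := hl_form hd hc hε b 0 (e p) (fun _ _ => rfl) (fun v h => he _ v h) (by simp) 0
    simpa only [smul_zero, zero_add] using this)
  rwa [Module.finrank_fintype_fun_eq_card, Fintype.card_subtype] at this

variable (G) in
/-- The Gram form on pairs of vertices. -/
noncomputable def hlK (ε : ℝ) (c : V → Bool) (u v : V) : ℝ :=
  ∑ w ∈ hlC G c u, ∑ w' ∈ hlC G c v, hlDe G ε c w w'

lemma hlN_single (c : V → Bool) (v : V) :
    hlN G c *ᵥ Pi.single v 1 = fun w => if w ∈ hlC G c v then 1 else 0 := by
  rw [mulVec_single_one]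
  funext w
  simp only [Matrix.col_apply, hlN, Matrix.of_apply, hl_mem_C, G.adj_comm w v, ne_comm (a := c v)]

lemma hlK_eq (ε : ℝ) (c : V → Bool) (u v : V) :
    (hlN G c *ᵥ Pi.single u 1) ⬝ᵥ hlD G ε c *ᵥ (hlN G c *ᵥ Pi.single v 1) = hlK G ε c u v := by
  rw [hlN_single, hlN_single]
  simp only [dotProduct, mulVec, hlK, hlD, Matrix.of_apply, mul_ite, mul_one, mul_zero, ite_mul, one_mul, zero_mul]
  rw [← Finset.sum_filter, Finset.filter_mem_eq_inter, Finset.univ_inter]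
  refine Finset.sum_congr rfl fun w _ => ?_
  rw [← Finset.sum_filter, Finset.filter_mem_eq_inter, Finset.univ_inter]

lemma hlK_symm (ε : ℝ) (c : V → Bool) (u v : V) : hlK G ε c u v = hlK G ε c v u := by
  unfold hlK
  rw [Finset.sum_comm]
  exact Finset.sum_congr rfl fun w _ => Finset.sum_congr rfl fun w' _ => hlD_symm G ε c _ _

variable (G) in
/-- No test vector works. -/
def HlBad (ε : ℝ) : Prop := ∀ c : V → Bool, HlMin G c → HlBal c →
  (∀ v, √2 < hlK G ε c v v) ∧ (∀ u v, u ≠ v → c u = c v → ∀ δ : ℝ, (δ = 1 ∨ δ = -1) →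
    2 * √2 - 2 * ε * δ * (if G.Adj u v then 1 else 0) < hlK G ε c u u + hlK G ε c v v + 2 * δ * hlK G ε c u v)

lemma hl_bad (hd : ∀ v, G.degree v ≤ 3) {ε : ℝ} (hε : ε = 1 ∨ ε = -1)
    {ι : Type*} [Fintype ι] (μ : ι → ℝ) (hμ : (G.adjMatrix ℝ).charpoly = ∏ i, (X - C (μ i)))
    (h : Fintype.card V ≤ 2 * (Finset.univ.filter fun i => √2 < ε * μ i).card + 1) :
    HlBad G ε := by
  intro c hc hb
  have key : ∀ (b : Bool) (x : V → ℝ), (∀ v, c v ≠ b → x v = 0) → x ≠ 0 →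
      √2 * (x ⬝ᵥ x) - ε * (x ⬝ᵥ hlM G c *ᵥ x) <
        (hlN G c *ᵥ x) ⬝ᵥ hlD G ε c *ᵥ (hlN G c *ᵥ x) := by
    intro b x hx hx0
    by_contra hn
    have h1 := hl_test hd hc hε b x hx hx0 (not_lt.1 hn) μ hμ
    have h2 := Finset.card_filter_add_card_filter_not (s := (Finset.univ : Finset V))
      (fun v => c v = true)
    rw [Finset.card_univ] at h2
    unfold HlBal at hb
    cases b
    · simp only [ne_eq, Bool.not_eq_false, Bool.not_eq_true] at h1 h2
      omega
    · simp only [ne_eq, Bool.not_eq_true] at h1 h2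
      omega
  have hMd : ∀ v, hlM G c v v = 0 := by intro v; simp [hlM]
  constructor
  · intro v
    have := key (c v) (Pi.single v 1) (fun w hw => by
      rw [Pi.single_eq_of_ne]; rintro rfl; exact hw rfl) (by simp)
    rw [hlK_eq] at this
    simpa [hMd] using this
  · intro u v huv huv' δ hδ
    have hδδ : δ * δ = 1 := by rcases hδ with rfl | rfl <;> norm_num
    have := key (c v) (Pi.single u 1 + δ • Pi.single v 1) (fun w hw => by
      have h1 : w ≠ u := by rintro rfl; exact hw huv'
      have h2 : w ≠ v := by rintro rfl; exact hw rfl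
      simp [h1, h2]) (fun h0 => by
        have := congrFun h0 u
        simp [huv] at this)
    simp only [mulVec_add, mulVec_smul, dotProduct_add, add_dotProduct, smul_dotProduct,
      dotProduct_smul, hlK_eq, smul_eq_mul, hlK_symm ε c v u] at this
    have hMs : hlM G c v u = hlM G c u v := by
      conv_lhs => rw [← hlM_symm]
      rfl
    simp only [mulVec_single_one, single_dotProduct, one_mul, Matrix.col_apply, hMd, hMs,
      Pi.single_eq_same, Pi.single_eq_of_ne huv, Pi.single_eq_of_ne huv.symm] at this
    have hMu : hlM G c u v = (if G.Adj u v then 1 else 0) := by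
      simp [hlM, huv']
    simp only [hMu] at this
    rcases hδ with rfl | rfl <;> linarith

end Test

section Local

set_option linter.unusedSectionVars false

variable {V : Type*} [Fintype V] [DecidableEq V] {G : SimpleGraph V} [DecidableRel G.Adj]

lemma hl_sqrt : √2 * √2 = 2 ∧ 1.41 < √2 ∧ √2 < 1.42 := by
  have h : √2 * √2 = 2 := Real.mul_self_sqrt (by norm_num)
  have h0 := Real.sqrt_nonneg 2
  exact ⟨h, by nlinarith, by nlinarith⟩

lemma hl_side {c : V → Bool} {v a b : V} (ha : a ∈ hlC G c v) (hb : b ∈ hlC G c v) :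
    c a = c b := by
  rw [hl_mem_C] at ha hb
  have h1 := ha.2
  have h2 := hb.2
  revert h1 h2
  cases c a <;> cases c b <;> cases c v <;> simp

lemma hl_C_symm {c : V → Bool} {v a : V} (ha : a ∈ hlC G c v) : v ∈ hlC G c a := by
  rw [hl_mem_C] at ha ⊢
  exact ⟨ha.1.symm, ha.2.symm⟩

lemma hlDe_diag_le (ε : ℝ) (c : V → Bool) (w : V) : hlDe G ε c w w ≤ √2 := by
  obtain ⟨h1, h2, h3⟩ := hl_sqrt
  by_cases h : HlMt G c w
  · rw [hlD_diag G h]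
  · rw [hlD_diag' G h]; linarith

lemma hlDe_zero_left (ε : ℝ) {c : V → Bool} {a b : V} (hne : a ≠ b) (h : ¬ HlMt G c a) :
    hlDe G ε c a b = 0 :=
  hlD_zero G hne fun h' => h ⟨b, h'⟩

lemma hlDe_zero_right (ε : ℝ) {c : V → Bool} {a b : V} (hne : a ≠ b) (h : ¬ HlMt G c b) :
    hlDe G ε c a b = 0 := by
  rw [hlD_symm]; exact hlDe_zero_left ε hne.symm h

lemma hl_C_cases (hd : ∀ v, G.degree v ≤ 3) {c : V → Bool} {v : V} (hv : HlMt G c v) :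
    hlC G c v = ∅ ∨ (∃ a, hlC G c v = {a}) ∨ ∃ a b, a ≠ b ∧ hlC G c v = {a, b} := by
  have h := hv.C_card hd
  interval_cases h' : (hlC G c v).card
  · left; exact Finset.card_eq_zero.1 h'
  · right; left; exact Finset.card_eq_one.1 h'
  · right; right; exact Finset.card_eq_two.1 h'

lemma hlK_pair (ε : ℝ) (c : V → Bool) {u v a b x y : V} (hab : a ≠ b) (hxy : x ≠ y)
    (hu : hlC G c u = {a, b}) (hv : hlC G c v = {x, y}) :
    hlK G ε c u v = hlDe G ε c a x + hlDe G ε c a y + (hlDe G ε c b x + hlDe G ε c b y) := by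
  rw [hlK, hu, hv, Finset.sum_pair hab, Finset.sum_pair hxy, Finset.sum_pair hxy]

lemma hlK_diag (hd : ∀ v, G.degree v ≤ 3) (ε : ℝ) {c : V → Bool} (hc : HlMin G c) {v : V}
    (hv : HlMt G c v) : hlK G ε c v v ≤ 3 / 2 * √2 ∨
      ∃ a b, a ≠ b ∧ hlC G c v = {a, b} ∧ G.Adj a b ∧ hlK G ε c v v = 2 * √2 + 2 * ε := by
  obtain ⟨s1, s2, s3⟩ := hl_sqrt
  rcases hl_C_cases hd hv with h | ⟨a, h⟩ | ⟨a, b, hab, h⟩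
  · left; rw [hlK, h]; simp
  · left; rw [hlK, h]
    have := hlDe_diag_le (G := G) ε c a
    simp only [Finset.sum_singleton]
    linarith
  · have ha : a ∈ hlC G c v := by simp [h]
    have hb : b ∈ hlC G c v := by simp [h]
    rw [hlK_pair ε c hab hab h h]
    by_cases h1 : HlMt G c a
    · by_cases h2 : HlMt G c b
      · right
        have hadj := hc.struct hd hv ha hb hab h1 h2
        refine ⟨a, b, hab, h, hadj, ?_⟩
        rw [hlD_diag G h1, hlD_diag G h2, hlD_adj G hadj (hl_side hb ha),
          hlD_adj G hadj.symm (hl_side ha hb)]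
        ring
      · left
        rw [hlDe_zero_right ε hab h2, hlDe_zero_left ε hab.symm h2, hlD_diag' G h2]
        have := hlDe_diag_le (G := G) ε c a
        linarith
    · left
      rw [hlDe_zero_left ε hab h1, hlDe_zero_right ε hab.symm h1, hlD_diag' G h1]
      have := hlDe_diag_le (G := G) ε c b
      linarith

/-- In a bad graph every balanced maximum cut has an interior edge. -/
lemma hl_interior (hd : ∀ v, G.degree v ≤ 3) {ε : ℝ} (hbad : HlBad G ε) {c : V → Bool}
    (hc : HlMin G c) (hb : HlBal c) (v0 : V) : ∃ v, HlMt G c v := by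
  obtain ⟨s1, s2, s3⟩ := hl_sqrt
  by_contra hno
  push Not at hno
  have hK : ∀ u v, hlK G ε c u v = √2 / 2 * ((hlC G c u ∩ hlC G c v).card : ℝ) := by
    intro u v
    have : ∀ w w', hlDe G ε c w w' = if w = w' then √2 / 2 else 0 := by
      intro w w'
      split_ifs with h
      · subst h; exact hlD_diag' G (hno w)
      · exact hlDe_zero_left ε h (hno w)
    unfold hlK
    simp only [this, Finset.sum_ite_eq]
    rw [← Finset.sum_filter, Finset.filter_mem_eq_inter, Finset.sum_const, nsmul_eq_mul]
    ring
  obtain ⟨h1, h2⟩ := hbad c hc hb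
  have hone : ∀ w, (hlC G c w).card ≤ 1 := by
    intro w
    rw [Finset.card_le_one]
    intro a ha b hb
    by_contra hab
    have hnadj : ¬ G.Adj a b := fun h => hno a ⟨b, h, hl_side hb ha⟩
    have h3 := h2 a b hab (hl_side ha hb) (-1) (Or.inr rfl)
    rw [hK, hK, hK, if_neg hnadj, Finset.inter_self, Finset.inter_self] at h3
    have k1 : ((hlC G c a).card : ℝ) ≤ 3 := by exact_mod_cast hlC_card hd c a
    have k2 : ((hlC G c b).card : ℝ) ≤ 3 := by exact_mod_cast hlC_card hd c b
    have k3 : (1 : ℝ) ≤ ((hlC G c a ∩ hlC G c b).card : ℝ) := by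
      have : 0 < (hlC G c a ∩ hlC G c b).card :=
        Finset.card_pos.2 ⟨w, Finset.mem_inter.2 ⟨hl_C_symm ha, hl_C_symm hb⟩⟩
      exact_mod_cast this
    nlinarith
  have h3 := h1 v0
  rw [hK, Finset.inter_self] at h3
  have k1 : ((hlC G c v0).card : ℝ) ≤ 1 := by exact_mod_cast hone v0
  nlinarith

lemma hl_upper (hd : ∀ v, G.degree v ≤ 3) (hbad : HlBad G 1) {c : V → Bool}
    (hc : HlMin G c) (hb : HlBal c) (v0 : V) : False := by
  obtain ⟨s1, s2, s3⟩ := hl_sqrt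
  obtain ⟨v, v', hv, hvc⟩ := hl_interior hd hbad hc hb v0
  obtain ⟨-, h2⟩ := hbad c hc hb
  have hD0 : ∀ a b, 0 ≤ hlDe G 1 c a b := by
    intro a b
    unfold hlDe
    split_ifs <;> linarith
  have bad2 : ∀ p q, G.Adj p q → c p = c q →
      2 * √2 + 2 < hlK G 1 c p p + hlK G 1 c q q - 2 * hlK G 1 c p q := by
    intro p q hpq hs
    have := h2 p q hpq.ne hs (-1) (Or.inr rfl)
    rw [if_pos hpq] at this
    linarith
  have hmax : ∀ p, HlMt G c p → hlK G 1 c p p ≤ 2 * √2 + 2 := by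
    intro p hp
    rcases hlK_diag hd 1 hc hp with h | ⟨a, b, -, -, -, h⟩ <;> linarith
  have step : ∀ p q, G.Adj p q → c p = c q →
      (∃ a b, a ≠ b ∧ hlC G c p = {a, b} ∧ G.Adj a b) ∨
      (∃ a b, a ≠ b ∧ hlC G c q = {a, b} ∧ G.Adj a b) := by
    intro p q hpq hs
    rcases hlK_diag hd 1 hc ⟨q, hpq, hs.symm⟩ with h | ⟨a, b, h1, h2, h3, h4⟩
    · rcases hlK_diag hd 1 hc ⟨p, hpq.symm, hs⟩ with h' | ⟨a, b, h1, h2, h3, h4⟩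
      · exfalso
        have h5 := bad2 p q hpq hs
        have h6 : 0 ≤ hlK G 1 c p q :=
          Finset.sum_nonneg fun _ _ => Finset.sum_nonneg fun _ _ => hD0 _ _
        linarith
      · right; exact ⟨a, b, h1, h2, h3⟩
    · left; exact ⟨a, b, h1, h2, h3⟩
  have sub : ∀ p a b, G.Adj a b → c a = c b → p ∈ hlC G c a → p ∈ hlC G c b →
      (∃ x y, x ≠ y ∧ hlC G c a = {x, y} ∧ G.Adj x y) → False := by
    rintro p a b hab hs hpa hpb ⟨x, y, hxy, hC, hadj⟩
    have h5 := bad2 a b hab hs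
    have h6 := hmax a ⟨b, hab, hs.symm⟩
    have h7 := hmax b ⟨a, hab.symm, hs⟩
    have hx : x ∈ hlC G c a := by simp [hC]
    have hy : y ∈ hlC G c a := by simp [hC]
    have hsxy := hl_side hx hy
    have hle : ∀ w, hlDe G 1 c w p ≤ ∑ w' ∈ hlC G c b, hlDe G 1 c w w' := fun w =>
      Finset.single_le_sum (f := fun w' => hlDe G 1 c w w') (fun _ _ => hD0 _ _) hpb
    have h8 : hlDe G 1 c x p + hlDe G 1 c y p ≤ hlK G 1 c a b := by
      unfold hlK
      rw [hC, Finset.sum_pair hxy]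
      exact add_le_add (hle x) (hle y)
    have h9 : hlDe G 1 c x p + hlDe G 1 c y p = √2 + 1 := by
      have : p = x ∨ p = y := by simpa [hC] using hpa
      rcases this with rfl | rfl
      · rw [hlD_diag G ⟨y, hadj, hsxy.symm⟩, hlD_adj G hadj.symm hsxy]
      · rw [hlD_diag G ⟨x, hadj.symm, hsxy⟩, hlD_adj G hadj hsxy.symm]; ring
    linarith
  have step2 : ∀ p, (∃ a b, a ≠ b ∧ hlC G c p = {a, b} ∧ G.Adj a b) → False := by
    rintro p ⟨a, b, hab, hC, hadj⟩
    have ha : a ∈ hlC G c p := by simp [hC]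
    have hb : b ∈ hlC G c p := by simp [hC]
    rcases step a b hadj (hl_side ha hb) with h | h
    · exact sub p a b hadj (hl_side ha hb) (hl_C_symm ha) (hl_C_symm hb) h
    · exact sub p b a hadj.symm (hl_side hb ha) (hl_C_symm hb) (hl_C_symm ha) h
  rcases step v v' hv hvc.symm with h | h
  · exact step2 _ h
  · exact step2 _ h

/-! The lower bound. -/

lemma hl_low_bad (hbad : HlBad G (-1)) {c : V → Bool} (hc : HlMin G c) (hb : HlBal c) {p q : V}
    (hpq : G.Adj p q) (hs : c p = c q) :
    2 * √2 + 2 < hlK G (-1) c p p + hlK G (-1) c q q + 2 * hlK G (-1) c p q := by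
  have := (hbad c hc hb).2 p q hpq.ne hs 1 (Or.inl rfl)
  rw [if_pos hpq] at this
  linarith

lemma hl_low_diag (hd : ∀ v, G.degree v ≤ 3) {c : V → Bool} (hc : HlMin G c) {v : V}
    (hv : HlMt G c v) : hlK G (-1) c v v ≤ 3 / 2 * √2 := by
  obtain ⟨s1, s2, s3⟩ := hl_sqrt
  rcases hlK_diag hd (-1) hc hv with h | ⟨a, b, -, -, -, h⟩ <;> linarith

lemma hl_low_off {c : V → Bool} {a b : V} (h : a ≠ b) : hlDe G (-1) c a b ≤ 0 := by
  unfold hlDe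
  rw [if_neg h]
  split_ifs <;> norm_num

lemma hl_L1 (hd : ∀ v, G.degree v ≤ 3) (hbad : HlBad G (-1)) {c : V → Bool}
    (hc : HlMin G c) (hb : HlBal c) {p q : V} (hpq : G.Adj p q) (hs : c p = c q) :
    ∃ w, w ∈ hlC G c p ∧ w ∈ hlC G c q := by
  obtain ⟨s1, s2, s3⟩ := hl_sqrt
  by_contra hno
  push Not at hno
  have h1 := hl_low_bad hbad hc hb hpq hs
  have h2 := hl_low_diag hd hc ⟨q, hpq, hs.symm⟩
  have h3 := hl_low_diag hd hc ⟨p, hpq.symm, hs⟩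
  have h4 : hlK G (-1) c p q ≤ 0 :=
    Finset.sum_nonpos fun w hw => Finset.sum_nonpos fun w' hw' =>
      hl_low_off (by rintro rfl; exact hno w hw hw')
  linarith

lemma hl_L2_aux (hd : ∀ v, G.degree v ≤ 3) (hbad : HlBad G (-1)) {c : V → Bool}
    (hc : HlMin G c) (hb : HlBal c) {p q w w' : V} (hpq : G.Adj p q) (hs : c p = c q)
    (hw : w ∈ hlC G c p) (hw' : w' ∈ hlC G c p) (hww : G.Adj w w') : False := by
  obtain ⟨s1, s2, s3⟩ := hl_sqrt
  have hmp : HlMt G c p := ⟨q, hpq, hs.symm⟩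
  have hmq : HlMt G c q := ⟨p, hpq.symm, hs⟩
  have hsw := hl_side hw hw'
  have hCp : hlC G c p = {w, w'} := by
    symm
    apply Finset.eq_of_subset_of_card_le
    · intro t ht
      simp only [Finset.mem_insert, Finset.mem_singleton] at ht
      rcases ht with rfl | rfl <;> assumption
    · rw [Finset.card_pair hww.ne]; exact hmp.C_card hd
  have hmw : HlMt G c w := ⟨w', hww, hsw.symm⟩
  have hmw' : HlMt G c w' := ⟨w, hww.symm, hsw⟩
  have h1 := hl_low_bad hbad hc hb hpq hs
  have h2 : hlK G (-1) c p p = 2 * √2 - 2 := by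
    rw [hlK_pair (-1) c hww.ne hww.ne hCp hCp, hlD_diag G hmw, hlD_diag G hmw',
      hlD_adj G hww hsw.symm, hlD_adj G hww.symm hsw]
    ring
  have h3 := hl_low_diag hd hc hmq
  have hb1 : ∀ b, hlDe G (-1) c w b + hlDe G (-1) c w' b ≤ √2 - 1 := by
    intro b
    by_cases hb1 : w = b
    · subst hb1
      rw [hlD_diag G hmw, hlD_adj G hww.symm hsw]; linarith
    by_cases hb2 : w' = b
    · subst hb2
      rw [hlD_diag G hmw', hlD_adj G hww hsw.symm]; linarith
    have := hl_low_off (G := G) (c := c) hb1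
    have := hl_low_off (G := G) (c := c) hb2
    linarith
  have h4 : hlK G (-1) c p q ≤ 2 * (√2 - 1) := by
    unfold hlK
    rw [hCp, Finset.sum_pair hww.ne, ← Finset.sum_add_distrib]
    calc _ ≤ ∑ _b ∈ hlC G c q, (√2 - 1) := Finset.sum_le_sum fun b _ => hb1 b
      _ = (hlC G c q).card * (√2 - 1) := by rw [Finset.sum_const, nsmul_eq_mul]
      _ ≤ 2 * (√2 - 1) := by
        have : ((hlC G c q).card : ℝ) ≤ 2 := by exact_mod_cast hmq.C_card hd
        nlinarith
  linarith

lemma hl_L2 (hd : ∀ v, G.degree v ≤ 3) (hbad : HlBad G (-1)) {c : V → Bool}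
    (hc : HlMin G c) (hb : HlBal c) {p q w : V} (hpq : G.Adj p q) (hs : c p = c q)
    (hwp : w ∈ hlC G c p) (hwq : w ∈ hlC G c q) : ¬ HlMt G c w := by
  rintro ⟨w', hww, hwc⟩
  obtain ⟨u, hu, hu'⟩ := hl_L1 hd hbad hc hb hww hwc.symm
  have hwp' := (hl_mem_C G c p w).1 hwp
  have hwq' := (hl_mem_C G c q w).1 hwq
  have huw := (hl_mem_C G c w u).1 hu
  have hpw' : p ≠ w' := by rintro rfl; exact hwp'.2 hwc.symm
  have hqw' : q ≠ w' := by rintro rfl; exact hwq'.2 hwc.symm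
  have huw' : u ≠ w' := by rintro rfl; exact huw.2 hwc
  have : u = p ∨ u = q := by
    by_contra hn
    push Not at hn
    exact hl_four hd hwp'.1.symm hwq'.1.symm hww huw.1 hpq.ne hpw' hn.1.symm hqw' hn.2.symm
      huw'.symm
  rcases this with rfl | rfl
  · exact hl_L2_aux hd hbad hc hb hpq hs hwp (hl_C_symm hu') hww
  · exact hl_L2_aux hd hbad hc hb hpq.symm hs.symm hwq (hl_C_symm hu') hww

lemma hl_L3_aux (hd : ∀ v, G.degree v ≤ 3) (hbad : HlBad G (-1)) {c : V → Bool}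
    (hc : HlMin G c) (hb : HlBal c) {p w : V} (hp : HlMt G c p)
    (hw : w ∈ hlC G c p) (hm : ¬ HlMt G c w) :
    ∃ w1, w ≠ w1 ∧ HlMt G c w1 ∧ hlC G c p = {w, w1} := by
  obtain ⟨s1, s2, s3⟩ := hl_sqrt
  have h1 := (hbad c hc hb).1 p
  rcases hl_C_cases hd hp with h | ⟨a, h⟩ | ⟨a, b, hab, h⟩
  · simp [h] at hw
  · exfalso
    have : w = a := by simpa [h] using hw
    subst this
    rw [hlK, h] at h1
    simp only [Finset.sum_singleton] at h1
    rw [hlD_diag' G hm] at h1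
    linarith
  · have key : ∀ b, w ≠ b → hlC G c p = {w, b} → HlMt G c b := by
      intro b hwb h
      by_contra hmb
      rw [hlK_pair (-1) c hwb hwb h h, hlD_diag' G hm, hlD_diag' G hmb,
        hlDe_zero_left _ hwb hm, hlDe_zero_left _ hwb.symm hmb] at h1
      linarith
    have : w = a ∨ w = b := by simpa [h] using hw
    rcases this with rfl | rfl
    · exact ⟨b, hab, key b hab h, h⟩
    · rw [Finset.pair_comm] at h
      exact ⟨a, hab.symm, key a hab.symm h, h⟩

lemma hl_L3 (hd : ∀ v, G.degree v ≤ 3) (hbad : HlBad G (-1)) {c : V → Bool}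
    (hc : HlMin G c) (hb : HlBal c) {p q : V} (hpq : G.Adj p q) (hs : c p = c q) :
    ∃ w w1 w2, w ≠ w1 ∧ w ≠ w2 ∧ w1 ≠ w2 ∧ ¬ HlMt G c w ∧ HlMt G c w1 ∧ HlMt G c w2 ∧
      hlC G c p = {w, w1} ∧ hlC G c q = {w, w2} ∧ ¬ G.Adj w1 w2 := by
  obtain ⟨s1, s2, s3⟩ := hl_sqrt
  obtain ⟨w, hwp, hwq⟩ := hl_L1 hd hbad hc hb hpq hs
  have hm := hl_L2 hd hbad hc hb hpq hs hwp hwq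
  obtain ⟨w1, n1, m1, e1⟩ := hl_L3_aux hd hbad hc hb ⟨q, hpq, hs.symm⟩ hwp hm
  obtain ⟨w2, n2, m2, e2⟩ := hl_L3_aux hd hbad hc hb ⟨p, hpq.symm, hs⟩ hwq hm
  have h1p : w1 ∈ hlC G c p := by simp [e1]
  have h2q : w2 ∈ hlC G c q := by simp [e2]
  have n12 : w1 ≠ w2 := by
    rintro rfl
    exact hl_L2 hd hbad hc hb hpq hs h1p h2q m1
  refine ⟨w, w1, w2, n1, n2, n12, hm, m1, m2, e1, e2, fun hadj => ?_⟩
  have h1 := hl_low_bad hbad hc hb hpq hs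
  have hside : c w2 = c w1 := (hl_side h2q hwq).trans (hl_side hwp h1p)
  rw [hlK_pair (-1) c n1 n1 e1 e1, hlK_pair (-1) c n2 n2 e2 e2, hlK_pair (-1) c n1 n2 e1 e2,
    hlD_diag' G hm, hlD_diag G m1, hlD_diag G m2, hlDe_zero_left _ n1 hm, hlDe_zero_left _ n2 hm,
    hlDe_zero_right _ n1.symm hm, hlDe_zero_right _ n2.symm hm, hlD_adj G hadj hside] at h1
  linarith

lemma hl_final_aux (hd : ∀ v, G.degree v ≤ 3) (hbad : HlBad G (-1)) {c : V → Bool}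
    (hc : HlMin G c) (hb : HlBal c) {v v' w w1 : V} (hv : G.Adj v v') (hs : c v = c v')
    (hm : ¬ HlMt G c w) (m1 : HlMt G c w1) (hne : w ≠ w1)
    (e1 : hlC G c v = {w, w1}) (hwv' : w ∈ hlC G c v') :
    ∃ z w1', G.Adj w z ∧ G.Adj z w1 ∧ G.Adj z w1' ∧ G.Adj w1 w1' ∧ c w1' = c w1 ∧
      ¬ HlMt G c z := by
  obtain ⟨w1', h1, h1c⟩ := id m1
  have hmv : HlMt G c v := ⟨v', hv, hs.symm⟩
  have hwv : w ∈ hlC G c v := by simp [e1]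
  have hw1v : w1 ∈ hlC G c v := by simp [e1]
  obtain ⟨z1, x1, x2, k1, k2, k3, k4, k5, k6, k7, k8, k9⟩ := hl_L3 hd hbad hc hb h1 h1c.symm
  have hvC : v ∈ hlC G c w1 := hl_C_symm hw1v
  have hvx : v = x1 := by
    have : v = z1 ∨ v = x1 := by simpa [k7] using hvC
    rcases this with rfl | h
    · exact absurd hmv k4
    · exact h
  subst hvx
  have hz1 : G.Adj w1 z1 := ((hl_mem_C G c w1 z1).1 (by simp [k7])).1
  have hz1' : G.Adj w1' z1 := ((hl_mem_C G c w1' z1).1 (by simp [k8])).1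
  refine ⟨z1, w1', ?_, hz1.symm, hz1'.symm, h1, h1c, k4⟩
  -- swap `v` and `w1`
  have hwv_ := (hl_mem_C G c v w).1 hwv
  have hw1v_ := (hl_mem_C G c v w1).1 hw1v
  have hwv'_ := (hl_mem_C G c v' w).1 hwv'
  have hvw1 : v ≠ w1 := hw1v_.1.ne
  have hmin := hc.swap hd hw1v_.1 hw1v_.2.symm hmv m1
  have hbal := hb.swap hw1v_.2.symm
  have hww1 : ¬ G.Adj w w1 := fun h => hm ⟨w1, h, hl_side hw1v hwv⟩
  have hcw : hlSwap c v w1 w = c w := hlSwap_of_ne c hwv_.1.ne' hne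
  have hcv : hlSwap c v w1 v = c w := by
    rw [hlSwap_left c hvw1]
    have := hwv_.2
    revert this; cases c w <;> cases c v <;> simp
  have hv'w1 : v' ≠ w1 := by rintro rfl; exact hw1v_.2 hs.symm
  have hcv' : hlSwap c v w1 v' = c v' := hlSwap_of_ne c hv.ne' hv'w1
  -- the edge `w v` is now interior
  obtain ⟨a, b, b2, l1, l2, l3, l4, l5, l6, l7, l8, l9⟩ :=
    hl_L3 hd hbad hmin hbal hwv_.1.symm (hcw.trans hcv.symm)
  have haw := (hl_mem_C G _ w a).1 (by rw [l7]; simp)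
  have hbw := (hl_mem_C G _ w b).1 (by rw [l7]; simp)
  have hav := (hl_mem_C G _ v a).1 (by rw [l8]; simp)
  -- the common neighbour `a` is `v'`
  have hav' : a = v' := by
    have haw1 : a ≠ w1 := by rintro rfl; exact hww1 haw.1
    by_contra hn
    exact hl_four hd hv hwv_.1 hw1v_.1 hav.1 hwv'_.1.ne hv'w1 (Ne.symm hn) hne haw.1.ne haw1.symm
  subst hav'
  have hbv : b ≠ v := by
    rintro rfl; exact hbw.2 (hcv.trans hcw.symm)
  have hbw1 : b ≠ w1 := by rintro rfl; exact hww1 hbw.1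
  have hcb : hlSwap c v w1 b = c b := hlSwap_of_ne c hbv hbw1
  obtain ⟨y, hy, hyc⟩ := l5
  rw [hcb] at hyc
  by_cases hyw : y = w1
  · subst hyw
    have hbC : b ∈ hlC G c y := by
      rw [hl_mem_C]
      refine ⟨hy.symm, ?_⟩
      have := hbw.2
      rw [hcb, hcw] at this
      rw [hl_side hw1v hwv]
      exact this
    have : b = z1 ∨ b = v := by simpa [k7] using hbC
    rcases this with rfl | h
    · exact hbw.1
    · exact absurd h hbv
  · exfalso
    by_cases hyv : y = v
    · subst hyv
      rw [hcv] at hyc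
      apply hbw.2
      rw [hcb, hcw, hyc]
    rw [hlSwap_of_ne c hyv hyw] at hyc
    -- `b` is matched with `y` in the original cut
    obtain ⟨r, r1, r2, j1, j2, j3, j4, j5, j6, j7, j8, j9⟩ := hl_L3 hd hbad hc hb hy hyc.symm
    have hwb : w ∈ hlC G c b := by
      rw [hl_mem_C]
      refine ⟨hbw.1.symm, ?_⟩
      have := hbw.2
      rw [hcb, hcw] at this
      exact this.symm
    have : w = r ∨ w = r1 := by simpa [j7] using hwb
    rcases this with rfl | rfl
    · have hwy := (hl_mem_C G c y w).1 (by rw [j8]; simp)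
      have hya : y ≠ a := by
        rintro rfl
        exact hbv (hc.uniq hd hy.symm hyc.symm hv.symm hs)
      exact hl_four hd hwv_.1.symm haw.1 hbw.1 hwy.1.symm hv.ne hbv.symm (Ne.symm hyv) l1
        hya.symm hy.ne
    · exact hm j5

lemma hl_lower (hd : ∀ v, G.degree v ≤ 3) (hbad : HlBad G (-1)) {c : V → Bool}
    (hc : HlMin G c) (hb : HlBal c) (v0 : V) : False := by
  obtain ⟨v, v', hv, hvc⟩ := hl_interior hd hbad hc hb v0
  obtain ⟨w, w1, w2, n1, n2, n12, hm, m1, m2, e1, e2, hna⟩ := hl_L3 hd hbad hc hb hv hvc.symm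
  have hwv : w ∈ hlC G c v := by simp [e1]
  have hwv' : w ∈ hlC G c v' := by simp [e2]
  obtain ⟨z1, x1, a1, a2, a3, a4, a5, a6⟩ :=
    hl_final_aux hd hbad hc hb hv hvc.symm hm m1 n1 e1 hwv'
  obtain ⟨z2, x2, b1, b2, b3, b4, b5, b6⟩ :=
    hl_final_aux hd hbad hc hb hv.symm hvc hm m2 n2 e2 hwv
  have hmv : HlMt G c v := ⟨v', hv, hvc⟩
  have hmv' : HlMt G c v' := ⟨v, hv.symm, hvc.symm⟩
  have ne : ∀ {p q}, HlMt G c p → ¬ HlMt G c q → p ≠ q := by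
    rintro p q h1 h2 rfl; exact h2 h1
  have hz : z1 = z2 := by
    by_contra hn
    exact hl_four hd ((hl_mem_C G c v w).1 hwv).1.symm ((hl_mem_C G c v' w).1 hwv').1.symm a1 b1
      hv.ne (ne hmv a6) (ne hmv b6) (ne hmv' a6) (ne hmv' b6) hn
  subst hz
  have hmx1 : HlMt G c x1 := ⟨w1, a4.symm, a5.symm⟩
  refine hl_four hd a1.symm a2 a3 b2 n1 (ne hmx1 hm).symm n2 a4.ne n12 ?_
  rintro rfl
  exact hna a4

end Local

section Bound

open Matrix Polynomial

variable {V : Type*} [Fintype V] [DecidableEq V] {G : SimpleGraph V} [DecidableRel G.Adj]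

lemma hl_main [Nonempty V] (hd : ∀ v, G.degree v ≤ 3) {ε : ℝ} (hε : ε = 1 ∨ ε = -1)
    {ι : Type*} [Fintype ι] (μ : ι → ℝ)
    (hμ : (G.adjMatrix ℝ).charpoly = ∏ i, (X - C (μ i))) :
    (Finset.univ.filter fun i => √2 < ε * μ i).card + (Fintype.card V / 2 + 1)
      ≤ Fintype.card V := by
  obtain ⟨c, hc⟩ := hl_exists_min (G := G)
  have hsum : (Finset.univ.filter fun v => c v = true).card +
      (Finset.univ.filter fun v => c v = false).card = Fintype.card V := by
    have := Finset.card_filter_add_card_filter_not (s := (Finset.univ : Finset V))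
      (fun v => c v = true)
    simpa using this
  by_cases hb : HlBal c
  · have hnot : ¬ (Fintype.card V ≤ 2 * (Finset.univ.filter fun i => √2 < ε * μ i).card + 1) := by
      intro h
      have hbad := hl_bad hd hε μ hμ h
      obtain ⟨v0⟩ := ‹Nonempty V›
      rcases hε with rfl | rfl
      · exact hl_upper hd hbad hc hb v0
      · exact hl_lower hd hbad hc hb v0
    unfold HlBal at hb
    omega
  · have h1 := hl_test_unbal hd hc hε true μ hμ
    have h2 := hl_test_unbal hd hc hε false μ hμ
    simp only [ne_eq, Bool.not_eq_true, Bool.not_eq_false] at h1 h2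
    unfold HlBal at hb
    omega

lemma hl_bound [Nonempty V] (hd : ∀ v, G.degree v ≤ 3) (μ : Fin (Fintype.card V) → ℝ)
    (ha : Antitone μ) (hμ : (G.adjMatrix ℝ).charpoly = ∏ i, (X - C (μ i)))
    (H L : Fin (Fintype.card V)) (hH : (H : ℕ) = (Fintype.card V - 1) / 2)
    (hL : (L : ℕ) = Fintype.card V / 2) : max |μ H| |μ L| ≤ √2 := by
  have h1 : μ H ≤ √2 := by
    by_contra! h
    have h1 := hl_main hd (Or.inl rfl) μ hμ
    have h2 : (Finset.Iic H).card ≤ (Finset.univ.filter fun i => √2 < 1 * μ i).card := by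
      apply Finset.card_le_card
      intro i hi
      have := ha (Finset.mem_Iic.1 hi)
      simp only [Finset.mem_filter, Finset.mem_univ, true_and]
      linarith
    rw [Fin.card_Iic] at h2
    omega
  have h2 : -√2 ≤ μ L := by
    by_contra! h
    have h1 := hl_main hd (Or.inr rfl) μ hμ
    have h2 : (Finset.Ici L).card ≤ (Finset.univ.filter fun i => √2 < -1 * μ i).card := by
      apply Finset.card_le_card
      intro i hi
      have := ha (Finset.mem_Ici.1 hi)
      simp only [Finset.mem_filter, Finset.mem_univ, true_and]
      linarith
    rw [Fin.card_Ici] at h2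
    omega
  have h3 : μ L ≤ μ H := ha (by rw [Fin.le_def]; omega)
  exact max_le (abs_le.2 ⟨by linarith, h1⟩) (abs_le.2 ⟨h2, by linarith⟩)

lemma hl_attained : ∃ (n : ℕ) (_ : 0 < n) (G : SimpleGraph (Fin n))
        (_ : DecidableRel G.Adj) (μ : Fin (Fintype.card (Fin n)) → ℝ)
        (H L : Fin (Fintype.card (Fin n))),
        (∀ v, G.degree v ≤ 3) ∧ G.IsEigenvalueSeq μ ∧
        (H : ℕ) = (n - 1) / 2 ∧ (L : ℕ) = n / 2 ∧ √2 = max |μ H| |μ L| := by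
  classical
  obtain ⟨e⟩ : Nonempty (Fin 14 ≃ ZMod 7 ⊕ ZMod 7) := ⟨(Fintype.equivFinOfCardEq hw_card).symm⟩
  let G : SimpleGraph (Fin 14) := heawoodGraph.comap e
  have iso : G ≃g heawoodGraph := SimpleGraph.Iso.comap e heawoodGraph
  have hA : G.adjMatrix ℝ = (hwMat.map (Nat.cast : ℕ → ℝ)).submatrix e e := by
    rw [← hw_adjMatrix]
    ext x y
    simp [G, SimpleGraph.adjMatrix_apply]
  have hch : (G.adjMatrix ℝ).charpoly = (hwMat.map (Nat.cast : ℕ → ℝ)).charpoly := by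
    rw [hA]
    have h := Matrix.charpoly_reindex e.symm (hwMat.map (Nat.cast : ℕ → ℝ))
    rw [Matrix.reindex_apply, Equiv.symm_symm] at h
    exact h
  have hH : (G.adjMatrix ℝ).IsHermitian := by
    rw [Matrix.IsHermitian, Matrix.conjTranspose_eq_transpose_of_trivial,
      SimpleGraph.transpose_adjMatrix]
  obtain ⟨μ, ha, hμ⟩ := hl_exists _ hH
  have hs := hw_spec (Fintype.card_fin 14) μ ha (hch ▸ hμ)
  have hc14 := Fintype.card_fin 14
  have s6 := (hs ⟨6, by simp⟩).2.1 (by simp) (by simp)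
  have s7 := (hs ⟨7, by simp⟩).2.2.1 (by simp) (by simp)
  refine ⟨14, by norm_num, G, Classical.decRel _, μ, ⟨6, by simp⟩, ⟨7, by simp⟩, ?_, ⟨ha, ?_⟩,
    by simp, by simp, ?_⟩
  · intro v
    have h1 := hw_regular (iso v)
    have h2 : heawoodGraph.degree (iso v) = G.degree v := iso.degree_eq v
    have : G.degree v ≤ 3 := by rw [← h2, h1]
    convert this
  · convert hμ
  · rw [s6, s7, abs_neg, max_self, abs_of_nonneg (Real.sqrt_nonneg 2)]

end Bound

/-- The Heawood graph is a 3-regular graph on 14 vertices whose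
adjacency eigenvalues, in decreasing order, are `3` (multiplicity 1), `√2`
(multiplicity 6), `-√2` (multiplicity 6) and `-3` (multiplicity 1).  In particular
the median eigenvalues are `λ_7 = √2` and `λ_8 = -√2`, so its HL-index is `√2`;
hence `√2` is the maximum (attained supremum) of the HL-indices of all graphs of
maximum degree at most 3. -/
theorem heawood_hl_index_and_sup :
    Fintype.card (ZMod 7 ⊕ ZMod 7) = 14 ∧
    heawoodGraph.IsRegularOfDegree 3 ∧
    (∀ (μ : Fin (Fintype.card (ZMod 7 ⊕ ZMod 7)) → ℝ), heawoodGraph.IsEigenvalueSeq μ →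
      ∀ i : Fin (Fintype.card (ZMod 7 ⊕ ZMod 7)),
        ((i : ℕ) = 0 → μ i = 3) ∧
        (1 ≤ (i : ℕ) → (i : ℕ) ≤ 6 → μ i = Real.sqrt 2) ∧
        (7 ≤ (i : ℕ) → (i : ℕ) ≤ 12 → μ i = -Real.sqrt 2) ∧
        ((i : ℕ) = 13 → μ i = -3)) ∧
    IsGreatest {r : ℝ | ∃ (n : ℕ) (_ : 0 < n) (G : SimpleGraph (Fin n))
        (_ : DecidableRel G.Adj) (μ : Fin (Fintype.card (Fin n)) → ℝ)
        (H L : Fin (Fintype.card (Fin n))),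
        (∀ v, G.degree v ≤ 3) ∧ G.IsEigenvalueSeq μ ∧
        (H : ℕ) = (n - 1) / 2 ∧ (L : ℕ) = n / 2 ∧ r = max |μ H| |μ L|}
      (Real.sqrt 2) := by
  refine ⟨hw_card, hw_regular, ?_, hl_attained, ?_⟩
  · intro μ hμ i
    obtain ⟨ha, hc⟩ := hμ
    refine hw_spec hw_card μ ha ?_ i
    rw [← hc, ← hw_adjMatrix]
  · rintro r ⟨n, hn, G, inst, μ, H, L, hd, ⟨ha, hc⟩, hH, hL, rfl⟩
    have : Nonempty (Fin n) := ⟨⟨0, hn⟩⟩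
    refine hl_bound hd μ ha ?_ H L (hH.trans (by rw [Fintype.card_fin]))
      (hL.trans (by rw [Fintype.card_fin]))
    rw [← hc]
    convert rfl
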